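/- arXiv:math/0701128 — 10 statements merged into one kernel-verified Lean document; each statement's English description precedes it below -/
import Mathlib

section
/- For every integer N > 2 and all positive integers n_1, …, n_N, the pretzel coloring matrix P(n_1, …, n_N) is ℤ-equivalent to the matrix M'(n_1, …, n_N); that is, there exist N×N integer matrices U and V of determinant ±1 such that U · P(n_1, …, n_N) · V = M'(n_1, …, n_N). -/
/-- The pretzel coloring matrix `P(n₁, …, n_N)` (indices of `n` are 1-based; matrix
rows and columns are 0-based). -/
def pretzelColoringMatrix (N : ℕ) (n : ℕ → ℤ) : Matrix (Fin N) (Fin N) ℤ :=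
  Matrix.of fun r c =>
    if (r : ℕ) + 2 < N then
      if (c : ℕ) = (r : ℕ) then -n ((r : ℕ) + 1)
      else if (c : ℕ) = (r : ℕ) + 1 then n ((r : ℕ) + 1) + n ((r : ℕ) + 2)
      else if (c : ℕ) = (r : ℕ) + 2 then -n ((r : ℕ) + 2)
      else 0
    else if (r : ℕ) + 2 = N then
      if (c : ℕ) = 0 then -n N
      else if (c : ℕ) + 2 = N then -n (N - 1)
      else if (c : ℕ) + 1 = N then n (N - 1) + n N
      else 0
    else
      if (c : ℕ) = 0 then n N + n 1
      else if (c : ℕ) = 1 then -n 1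
      else if (c : ℕ) + 1 = N then -n N
      else 0

/-- The matrix `M'(n₁, …, n_N)`: row `k`, for `1 ≤ k ≤ N-2`, has `-n k` in column
`k`, `n (k+1)` in column `k+1` and zeros elsewhere; row `N-1` has `-n N` in columns
`1` through `N-2`, `-n N - n (N-1)` in column `N-1` and `0` in column `N`;
row `N` is zero (all indices of `n` 1-based, matrix indices 0-based). -/
def pretzelM' (N : ℕ) (n : ℕ → ℤ) : Matrix (Fin N) (Fin N) ℤ :=
  Matrix.of fun r c =>
    if (r : ℕ) + 2 < N then
      if (c : ℕ) = (r : ℕ) then -n ((r : ℕ) + 1)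
      else if (c : ℕ) = (r : ℕ) + 1 then n ((r : ℕ) + 2)
      else 0
    else if (r : ℕ) + 2 = N then
      if (c : ℕ) + 2 < N then -n N
      else if (c : ℕ) + 2 = N then -n N - n (N - 1)
      else 0
    else 0

/-- Adds all the rows to the last one. -/
def addRowsToLast (N : ℕ) : Matrix (Fin N) (Fin N) ℤ :=
  Matrix.of fun r c => if r = c then 1 else if (r : ℕ) + 1 = N then 1 else 0

/-- The unitriangular matrix of the consecutive differences `x k - x (k + 1)`. -/
def consecutiveDiff (N : ℕ) : Matrix (Fin N) (Fin N) ℤ :=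
  Matrix.of fun r c => if r = c then 1 else if (r : ℕ) + 1 = c then -1 else 0

theorem det_addRowsToLast (N : ℕ) : (addRowsToLast N).det = 1 := by
  rw [Matrix.det_of_isLowerTriangular]
  · simp [addRowsToLast]
  · intro r c h
    have h' : (r : ℕ) < c := h
    have h₁ : r ≠ c := fun e => by simp [e] at h'
    have h₂ : (r : ℕ) + 1 ≠ N := by have := c.isLt; omega
    simp [addRowsToLast, h₁, h₂]

theorem det_consecutiveDiff (N : ℕ) : (consecutiveDiff N).det = 1 := by
  rw [Matrix.det_of_isUpperTriangular]
  · simp [consecutiveDiff]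
  · intro r c h
    have h' : (c : ℕ) < r := h
    have h₁ : r ≠ c := fun e => by simp [e] at h'
    have h₂ : (r : ℕ) + 1 ≠ c := by omega
    simp [consecutiveDiff, h₁, h₂]

theorem sum_col_pretzelColoringMatrix {N : ℕ} (hN : 2 < N) (n : ℕ → ℤ) (c : Fin N) :
    ∑ r, pretzelColoringMatrix N n r c = 0 := by
  let δ : ℕ → ℤ := fun j => if (c : ℕ) = j then 1 else 0
  let f : ℕ → ℤ := fun j =>
    if j + 1 < N then n (j + 1) * (δ (j + 1) - δ j)
    else if j + 1 = N then n N * (δ 0 - δ (N - 1))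
    else n 1 * (δ 1 - δ 0)
  have hf : ∀ r : Fin N, pretzelColoringMatrix N n r c = f r - f (r + 1) := by
    intro r
    have hr := r.isLt
    have hc := c.isLt
    rcases lt_trichotomy ((r : ℕ) + 2) N with h | h | h
    · simp only [pretzelColoringMatrix, Matrix.of_apply, f, δ]
      grind
    · have h' : N - 1 = (r : ℕ) + 1 := by omega
      simp only [pretzelColoringMatrix, Matrix.of_apply, f, δ, h']
      grind
    · have h' : N - 1 = (r : ℕ) := by omega
      simp only [pretzelColoringMatrix, Matrix.of_apply, f, δ, h']
      grind
  rw [Finset.sum_congr rfl fun r _ => hf r,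
    Fin.sum_univ_eq_sum_range (fun j => f j - f (j + 1)) N, Finset.sum_range_sub']
  have h₁ : 0 + 1 < N := by omega
  simp [f, h₁]

theorem mul_consecutiveDiff_apply {N : ℕ} (A : Matrix (Fin N) (Fin N) ℤ) (r c : Fin N) :
    (A * consecutiveDiff N) r c =
      A r c - if 0 < (c : ℕ) then A r ⟨c - 1, by omega⟩ else 0 := by
  have h : ∀ j, A r j * consecutiveDiff N j c =
      (if j = c then A r j else 0) - if (j : ℕ) + 1 = c then A r j else 0 := by
    intro j
    simp only [consecutiveDiff, Matrix.of_apply]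
    grind
  rw [Matrix.mul_apply, Finset.sum_congr rfl fun j _ => h j, Finset.sum_sub_distrib]
  congr 1
  · simp
  · split_ifs with hc
    · rw [Finset.sum_eq_single ⟨(c : ℕ) - 1, by omega⟩]
      · exact if_pos (Nat.sub_add_cancel hc)
      · intro j _ hj
        refine if_neg fun e => hj (Fin.ext ?_)
        simp [← e]
      · simp
    · exact Finset.sum_eq_zero fun j _ => if_neg (by omega)

theorem addRowsToLast_mul_pretzelColoringMatrix {N : ℕ} (hN : 2 < N) (n : ℕ → ℤ) :
    addRowsToLast N * pretzelColoringMatrix N n = pretzelM' N n * consecutiveDiff N := by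
  ext r c
  have hr := r.isLt
  have hc := c.isLt
  rw [mul_consecutiveDiff_apply, Matrix.mul_apply]
  by_cases h : (r : ℕ) + 1 = N
  · have h₁ : ¬ (r : ℕ) + 2 < N := by omega
    have h₂ : (r : ℕ) + 2 ≠ N := by omega
    simp [addRowsToLast, pretzelM', h, h₁, h₂, sum_col_pretzelColoringMatrix hN]
  · simp only [addRowsToLast, Matrix.of_apply, h, if_false, ite_mul, one_mul, zero_mul,
      Finset.sum_ite_eq, Finset.mem_univ, if_true]
    simp only [pretzelColoringMatrix, pretzelM', Matrix.of_apply]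
    grind

/-- For every integer `N > 2` and all positive integers
`n 1, …, n N`, the pretzel coloring matrix `P(n 1, …, n N)` is ℤ-equivalent to
`M'(n 1, …, n N)`: there are integer matrices `U`, `V` of determinant `±1` with
`U * P * V = M'`. -/
theorem pretzelColoringMatrix_equiv_M' (N : ℕ) (hN : 2 < N) (n : ℕ → ℤ)
    (hn : ∀ k, 1 ≤ k → k ≤ N → 0 < n k) :
    ∃ U V : Matrix (Fin N) (Fin N) ℤ,
      (U.det = 1 ∨ U.det = -1) ∧ (V.det = 1 ∨ V.det = -1) ∧
      U * pretzelColoringMatrix N n * V = pretzelM' N n := by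
  have hW := det_consecutiveDiff N
  refine ⟨addRowsToLast N, (consecutiveDiff N)⁻¹, Or.inl (det_addRowsToLast N), Or.inl ?_, ?_⟩
  · rw [Matrix.det_nonsing_inv, hW, Ring.inverse_one]
  · rw [addRowsToLast_mul_pretzelColoringMatrix hN,
      Matrix.mul_nonsing_inv_cancel_right _ _ (by simp [hW])]
end

section
/- Let N > 2 be an integer, let n_1, …, n_{N−1} be integers, and let Q be the (N−2)×(N−1) integer matrix with Q_{k,k} = −n_k and Q_{k,k+1} = n_{k+1} for 1 ≤ k ≤ N−2, and all other entries zero. Then for every 1 ≤ i ≤ N−2, every i-rowed minor of Q is either zero or equal, up to sign, to a product ∏_{s∈T} n_s for some subset T of {1, …, N−1} with exactly i elements. -/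
/-- The `(N-2) × (N-1)` matrix `Q` with `Q k k = -n k` and `Q k (k+1) = n (k+1)`
(1-based indexing of rows, columns, and of `n`; the matrix itself is 0-based). -/
def pretzelQ (N : ℕ) (n : ℕ → ℤ) : Matrix (Fin (N - 2)) (Fin (N - 1)) ℤ :=
  Matrix.of fun r c =>
    if (c : ℕ) = (r : ℕ) then -n ((r : ℕ) + 1)
    else if (c : ℕ) = (r : ℕ) + 1 then n ((r : ℕ) + 2)
    else 0

/-- The matrix with `-1` on the diagonal and `1` on the superdiagonal is totally unimodular:
its minors lie in `{0, 1, -1}`. -/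
theorem det_bidiagonal_submatrix (i : ℕ) (r c : Fin i → ℕ)
    (hr : StrictMono r) (hc : StrictMono c) :
    let d := (Matrix.of fun a b : Fin i =>
      if c b = r a then (-1 : ℤ) else if c b = r a + 1 then 1 else 0).det
    d = 0 ∨ d = 1 ∨ d = -1 := by
  induction i with
  | zero => simp
  | succ i ih =>
    have ih' := ih (r ∘ Fin.succ) (c ∘ Fin.succ)
      (hr.comp (Fin.strictMono_succ)) (hc.comp (Fin.strictMono_succ))
    intro d
    set e : ℤ := if c 0 = r 0 then (-1 : ℤ) else if c 0 = r 0 + 1 then 1 else 0 with he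
    have key : d = e * (Matrix.of fun a b : Fin i =>
        if (c ∘ Fin.succ) b = (r ∘ Fin.succ) a then (-1 : ℤ)
        else if (c ∘ Fin.succ) b = (r ∘ Fin.succ) a + 1 then 1 else 0).det := by
      rcases lt_or_ge (r 0) (c 0) with h | h
      · simp only [d]
        rw [Matrix.det_succ_row_zero, Fin.sum_univ_succ, Finset.sum_eq_zero]
        · simp only [Fin.val_zero, pow_zero, one_mul, add_zero, Matrix.of_apply, ← he]
          rfl
        · intro j _
          have hj : c 0 < c j.succ := hc (Fin.succ_pos j)
          rw [Matrix.of_apply, if_neg (by omega), if_neg (by omega)]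
          simp
      · simp only [d]
        rw [Matrix.det_succ_column_zero, Fin.sum_univ_succ, Finset.sum_eq_zero]
        · simp only [Fin.val_zero, pow_zero, one_mul, add_zero, Matrix.of_apply, ← he]
          rfl
        · intro j _
          have hj : r 0 < r j.succ := hr (Fin.succ_pos j)
          rw [Matrix.of_apply, if_neg (by omega), if_neg (by omega)]
          simp
    have he' : e = 0 ∨ e = 1 ∨ e = -1 := by
      rw [he]
      split_ifs <;> simp
    rw [key]
    rcases he' with h | h | h <;> rcases ih' with h' | h' | h' <;> rw [h, h'] <;> simp

/-- Each column of `pretzelQ` is a multiple of the corresponding `n`, so a minor is the product of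
these times a minor of the bidiagonal matrix. -/
theorem det_pretzelQ_submatrix (N : ℕ) (n : ℕ → ℤ) (i : ℕ)
    (r : Fin i → Fin (N - 2)) (c : Fin i → Fin (N - 1)) :
    ((pretzelQ N n).submatrix r c).det = (∏ j, n ((c j : ℕ) + 1)) *
      (Matrix.of fun a b : Fin i =>
        if (c b : ℕ) = r a then (-1 : ℤ) else if (c b : ℕ) = r a + 1 then 1 else 0).det := by
  rw [← Matrix.det_mul_row]
  congr 1
  ext a b
  simp only [pretzelQ, Matrix.submatrix_apply, Matrix.of_apply]
  split_ifs with h₁ h₂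
  · simp [h₁]
  · simp [h₂]
  · simp

/-- For `N > 2`, integers `n 1, …, n (N-1)` and `1 ≤ i ≤ N-2`,
every `i`-rowed minor of `Q` (i.e. the determinant of the submatrix of `Q` given
by strictly increasing choices of `i` rows and `i` columns) is either zero or
equal, up to sign, to `∏ s ∈ T, n s` for some subset `T ⊆ {1, …, N-1}` with
exactly `i` elements. -/
theorem pretzelQ_minor_eq_zero_or_prod (N : ℕ) (hN : 2 < N) (n : ℕ → ℤ)
    (i : ℕ) (hi1 : 1 ≤ i) (hi2 : i ≤ N - 2)
    (r : Fin i → Fin (N - 2)) (c : Fin i → Fin (N - 1))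
    (hr : StrictMono r) (hc : StrictMono c) :
    ((pretzelQ N n).submatrix r c).det = 0 ∨
      ∃ T : Finset ℕ, T ⊆ Finset.Icc 1 (N - 1) ∧ T.card = i ∧
        (((pretzelQ N n).submatrix r c).det = ∏ s ∈ T, n s ∨
          ((pretzelQ N n).submatrix r c).det = -∏ s ∈ T, n s) := by
  rw [det_pretzelQ_submatrix]
  have hinj : Function.Injective fun j => (c j : ℕ) + 1 := fun a b h =>
    hc.injective (Fin.ext (Nat.succ_injective h))
  rcases det_bidiagonal_submatrix i (fun j => r j) (fun j => c j) hr hc with h | h | h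
  · left
    rw [h, mul_zero]
  all_goals
    right
    refine ⟨Finset.univ.image fun j => (c j : ℕ) + 1, ?_, ?_, ?_⟩
    · intro s hs
      obtain ⟨j, -, rfl⟩ := Finset.mem_image.mp hs
      have := (c j).isLt
      exact Finset.mem_Icc.mpr ⟨by omega, by omega⟩
    · rw [Finset.card_image_of_injective _ hinj, Finset.card_univ, Fintype.card_fin]
    · rw [h, Finset.prod_image hinj.injOn]
      simp
end

section
/- Let N > 2 be an integer, let n_1, …, n_{N−1} be integers, and let Q be the (N−2)×(N−1) integer matrix with Q_{k,k} = −n_k and Q_{k,k+1} = n_{k+1} for 1 ≤ k ≤ N−2, and all other entries zero. Then for every 1 ≤ i ≤ N−2 and every choice of indices 1 ≤ s_1 < s_2 < ⋯ < s_i ≤ N−1, there exists an i-rowed minor of Q equal, up to sign, to the product n_{s_1}·n_{s_2}·⋯·n_{s_i}. -/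
namespace Matrix

/-- A matrix that is triangular with respect to some injective ordering of its index type
has determinant the product of its diagonal entries. -/
theorem BlockTriangular.det_of_injective {m α R : Type*} [Fintype m] [DecidableEq m]
    [LinearOrder α] [CommRing R] {M : Matrix m m R} {b : m → α}
    (hM : M.BlockTriangular b) (hb : Function.Injective b) : M.det = ∏ j, M j j := by
  rw [hM.det, Finset.prod_image fun _ _ _ _ h => hb h]
  refine Finset.prod_congr rfl fun j _ => ?_
  let : Unique {x // b x = b j} := ⟨⟨⟨j, rfl⟩⟩, fun x => Subtype.ext (hb x.2)⟩
  exact det_unique _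

end Matrix

/-- A family of fewer than `m` naturals misses some element of `{1, …, m}`. -/
theorem exists_mem_Icc_forall_ne {i m : ℕ} (h : i < m) (s : Fin i → ℕ) :
    ∃ v, 1 ≤ v ∧ v ≤ m ∧ ∀ j, s j ≠ v := by
  have hcard : (Finset.univ.image s).card < (Finset.Icc 1 m).card := by
    refine Finset.card_image_le.trans_lt ?_
    simpa using h
  obtain ⟨v, hv, hvs⟩ := Finset.exists_mem_notMem_of_card_lt_card hcard
  rw [Finset.mem_Icc] at hv
  exact ⟨v, hv.1, hv.2, fun j hj => hvs (Finset.mem_image.2 ⟨j, Finset.mem_univ j, hj⟩)⟩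

/-- For `N > 2`, integers `n 1, …, n (N-1)`, every `1 ≤ i ≤ N-2`
and every strictly increasing choice of indices `1 ≤ s 1 < s 2 < ⋯ < s i ≤ N-1`,
there is an `i`-rowed minor of `Q` (the determinant of a submatrix of `Q` given by
strictly increasing choices of `i` rows and `i` columns) equal, up to sign, to
`n (s 1) * n (s 2) * ⋯ * n (s i)`. -/
theorem pretzelQ_minor_realizes_prod (N : ℕ) (hN : 2 < N) (n : ℕ → ℤ)
    (i : ℕ) (hi1 : 1 ≤ i) (hi2 : i ≤ N - 2)
    (s : Fin i → ℕ) (hs : StrictMono s)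
    (hs1 : ∀ j, 1 ≤ s j) (hs2 : ∀ j, s j ≤ N - 1) :
    ∃ (r : Fin i → Fin (N - 2)) (c : Fin i → Fin (N - 1)),
      StrictMono r ∧ StrictMono c ∧
      (((pretzelQ N n).submatrix r c).det = ∏ j, n (s j) ∨
        ((pretzelQ N n).submatrix r c).det = -∏ j, n (s j)) := by
  obtain ⟨v, hv1, hv2, hv⟩ := exists_mem_Icc_forall_ne (show i < N - 1 by omega) s
  let r : Fin i → Fin (N - 2) := fun j =>
    ⟨if s j < v then s j - 1 else s j - 2, by
      have := hs1 j; have := hs2 j; have := hv j; split_ifs <;> omega⟩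
  let c : Fin i → Fin (N - 1) := fun j =>
    ⟨s j - 1, by have := hs1 j; have := hs2 j; omega⟩
  refine ⟨r, c, fun a b hab => ?_, fun a b hab => ?_, ?_⟩
  · have := hs hab; have := hs1 a; have := hv a; have := hv b
    simp only [r, Fin.mk_lt_mk]
    split_ifs <;> omega
  · have := hs hab; have := hs1 a
    simp only [c, Fin.mk_lt_mk]
    omega
  -- Rows and columns below `v` are ordered increasingly, those above `v` decreasingly.
  let b : Fin i → ℕ := fun j => if s j < v then s j else 2 * N - s j
  have hb : Function.Injective b := fun x y hxy => by
    refine hs.injective ?_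
    have := hs2 x; have := hs2 y
    simp only [b] at hxy
    split_ifs at hxy <;> omega
  have htri : ((pretzelQ N n).submatrix r c).BlockTriangular b := fun x y hxy => by
    have := hs1 x; have := hs1 y; have := hs2 x; have := hs2 y
    have := hv x; have := hv y
    simp only [b] at hxy
    simp only [pretzelQ, Matrix.submatrix_apply, Matrix.of_apply, r, c]
    rw [if_neg, if_neg] <;> split_ifs at hxy ⊢ <;> omega
  rw [htri.det_of_injective hb, ← abs_eq_abs, Finset.abs_prod, Finset.abs_prod]
  refine Finset.prod_congr rfl fun j _ => ?_
  have := hs1 j; have := hv j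
  simp only [pretzelQ, Matrix.submatrix_apply, Matrix.of_apply, r, c]
  by_cases hj : s j < v
  · rw [if_pos hj, if_pos rfl, abs_neg, Nat.sub_add_cancel (hs1 j)]
  · rw [if_neg hj, if_neg (by omega), if_pos (by omega), Nat.sub_add_cancel (by omega)]
end

section
/- Let N > 2 be an integer and n_1, …, n_N integers. The (N−1)×(N−1) integer matrix A whose row k, for 1 ≤ k ≤ N−2, has entry −n_k in column k, n_{k+1} in column k+1 and zeros elsewhere, and whose row N−1 has entry −n_N in each of the columns 1 through N−2 and entry −n_N − n_{N−1} in column N−1, satisfies det A = (−1)^{N−1} · Σ_{s=1}^{N} ∏_{j≠s} n_j, where the sum ranges over s = 1, …, N and each summand is the product of all n_j with j ≠ s. -/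
/-- The `(N-1) × (N-1)` matrix whose row `k`, for `1 ≤ k ≤ N-2`, has `-n k` in
column `k`, `n (k+1)` in column `k+1` and zeros elsewhere, and whose row `N-1`
has `-n N` in columns `1` through `N-2` and `-n N - n (N-1)` in column `N-1`
(indices of `n` and the row/column descriptions are 1-based; the matrix is
0-based). -/
def pretzelA (N : ℕ) (n : ℕ → ℤ) : Matrix (Fin (N - 1)) (Fin (N - 1)) ℤ :=
  Matrix.of fun r c =>
    if (r : ℕ) + 1 < N - 1 then
      if (c : ℕ) = (r : ℕ) then -n ((r : ℕ) + 1)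
      else if (c : ℕ) = (r : ℕ) + 1 then n ((r : ℕ) + 2)
      else 0
    else
      if (c : ℕ) + 1 < N - 1 then -n N
      else -n N - n (N - 1)

/-- Splits the sum of products with one factor omitted along an inserted element. -/
lemma Finset.sum_prod_erase_insert {ι R : Type*} [DecidableEq ι] [CommRing R] (f : ι → R)
    {s : Finset ι} {a : ι} (ha : a ∉ s) :
    ∑ i ∈ insert a s, ∏ j ∈ (insert a s).erase i, f j =
      ∏ j ∈ s, f j + f a * ∑ i ∈ s, ∏ j ∈ s.erase i, f j := by
  rw [Finset.sum_insert ha, Finset.erase_insert ha, Finset.mul_sum]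
  congr 1
  refine Finset.sum_congr rfl fun i hi => ?_
  have hne : a ≠ i := fun h => ha (h ▸ hi)
  rw [Finset.erase_insert_of_ne hne, Finset.prod_insert (fun h => ha (Finset.mem_of_mem_erase h))]

/-- The bidiagonal matrix with rows `-n (c + r), n (c + r + 1)`, closed off by a last row
`-b, …, -b, -b - n (c + m)`. -/
def borderedBidiagonal (n : ℕ → ℤ) (b : ℤ) (c m : ℕ) : Matrix (Fin (m + 1)) (Fin (m + 1)) ℤ :=
  Matrix.of fun r k =>
    if (r : ℕ) < m then
      if (k : ℕ) = r then -n (c + r) else if (k : ℕ) = r + 1 then n (c + r + 1) else 0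
    else if (k : ℕ) < m then -b else -b - n (c + m)

lemma borderedBidiagonal_submatrix_zero (n : ℕ → ℤ) (b : ℤ) (c m : ℕ) :
    (borderedBidiagonal n b c (m + 1)).submatrix (Fin.succAbove 0) Fin.succ =
      borderedBidiagonal n b (c + 1) m := by
  ext r k
  simp [borderedBidiagonal, add_assoc, add_comm, add_left_comm]

lemma det_borderedBidiagonal_submatrix_last (n : ℕ → ℤ) (b : ℤ) (c m : ℕ) :
    ((borderedBidiagonal n b c (m + 1)).submatrix (Fin.last (m + 1)).succAbove Fin.succ).det =
      ∏ j ∈ Finset.Ico (c + 1) (c + m + 2), n j := by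
  rw [Matrix.det_of_isLowerTriangular]
  · rw [Finset.prod_Ico_eq_prod_range, show c + m + 2 - (c + 1) = m + 1 by omega,
      Finset.prod_range]
    refine Finset.prod_congr rfl fun i _ => ?_
    have hi := i.isLt
    simp [borderedBidiagonal, add_right_comm, Nat.lt_succ_iff.mp hi |>.not_gt]
  · intro i j hij
    have hij' : (i : ℕ) < j := hij
    have hi := i.isLt
    simp only [borderedBidiagonal, Matrix.submatrix_apply, Matrix.of_apply, Fin.succAbove_last,
      Fin.val_castSucc, Fin.val_succ]
    rw [if_pos hi, if_neg (by omega), if_neg (by omega)]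

lemma det_borderedBidiagonal (n : ℕ → ℤ) (b : ℤ) (c m : ℕ) :
    (borderedBidiagonal n b c m).det =
      (-1) ^ (m + 1) * (∏ j ∈ Finset.Ico c (c + m + 1), n j +
        b * ∑ s ∈ Finset.Ico c (c + m + 1), ∏ j ∈ (Finset.Ico c (c + m + 1)).erase s, n j) := by
  induction m generalizing c with
  | zero => simp [borderedBidiagonal]; ring
  | succ m ih =>
    have hmem : c ∉ Finset.Ico (c + 1) (c + m + 2) := by simp
    have hIco : Finset.Ico c (c + (m + 1) + 1) = insert c (Finset.Ico (c + 1) (c + m + 2)) := by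
      ext x
      simp only [Finset.mem_insert, Finset.mem_Ico]
      omega
    rw [hIco, Finset.sum_prod_erase_insert n hmem, Finset.prod_insert hmem,
      Matrix.det_succ_column_zero, Fin.sum_univ_succ, Fin.sum_univ_castSucc, Fin.succ_last,
      borderedBidiagonal_submatrix_zero, det_borderedBidiagonal_submatrix_last, ih,
      show c + 1 + m + 1 = c + m + 2 by omega]
    have hmid (i : Fin m) : borderedBidiagonal n b c (m + 1) i.castSucc.succ 0 = 0 := by
      simp [borderedBidiagonal]
    simp only [hmid, mul_zero, zero_mul, Finset.sum_const_zero]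
    simp [borderedBidiagonal]
    ring

lemma pretzelA_eq_borderedBidiagonal (n : ℕ → ℤ) (m : ℕ) :
    pretzelA (m + 2) n = borderedBidiagonal n (n (m + 2)) 1 m := by
  ext r k
  simp [pretzelA, borderedBidiagonal, add_comm, add_left_comm]

/-- For `N > 2` and integers `n 1, …, n N`, the determinant of
the above matrix is `(-1) ^ (N-1) * ∑_{s=1}^{N} ∏_{j ≠ s} n j`. -/
theorem pretzelA_det (N : ℕ) (hN : 2 < N) (n : ℕ → ℤ) :
    (pretzelA N n).det =
      (-1 : ℤ) ^ (N - 1) *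
        ∑ s ∈ Finset.Icc 1 N, ∏ j ∈ (Finset.Icc 1 N).erase s, n j := by
  obtain ⟨m, rfl⟩ : ∃ m, N = m + 2 := ⟨N - 2, by omega⟩
  have hmem : m + 2 ∉ Finset.Ico 1 (1 + m + 1) := by simp; omega
  have hIcc : Finset.Icc 1 (m + 2) = insert (m + 2) (Finset.Ico 1 (1 + m + 1)) := by
    ext x
    simp only [Finset.mem_insert, Finset.mem_Icc, Finset.mem_Ico]
    omega
  rw [hIcc, Finset.sum_prod_erase_insert n hmem, pretzelA_eq_borderedBidiagonal]
  exact det_borderedBidiagonal n (n (m + 2)) 1 m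
end

section
/- Let N > 2 be an integer and n_1, …, n_N positive integers. For every 1 ≤ i ≤ N−2, the greatest common divisor of all i-rowed minors of the matrix M'(n_1, …, n_N) equals the greatest common divisor of all products n_{s_1}·n_{s_2}·⋯·n_{s_i} taken over all index choices 1 ≤ s_1 < s_2 < ⋯ < s_i ≤ N. -/
namespace Matrix

variable {R m p : Type*} [CommRing R] [Fintype m] [DecidableEq m]

theorem dvd_det_mul_of_forall_submatrix [Fintype p] {d : R} (X : Matrix m p R) (A : Matrix p m R)
    (h : ∀ f : m → p, d ∣ (A.submatrix f id).det) : d ∣ (X * A).det := by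
  classical
  have hrow : X * A = fun k => ∑ l, X k l • A l := by
    ext k c
    simp [mul_apply, Finset.sum_apply]
  have hexp : (X * A).det = ∑ f : m → p, (∏ k, X k (f k)) * (A.submatrix f id).det := by
    rw [hrow]
    change (detRowAlternating (R := R) (n := m)).toMultilinearMap
      (fun k => ∑ l, X k l • A l) = _
    rw [MultilinearMap.map_sum]
    refine Finset.sum_congr rfl fun f _ => ?_
    rw [MultilinearMap.map_smul_univ]
    rfl
  rw [hexp]
  exact Finset.dvd_sum fun f _ => (h f).mul_left _

theorem dvd_det_mul_mul_of_forall_submatrix {q : Type*} [Fintype p] [Fintype q] {d : R}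
    (X : Matrix m p R) (A : Matrix p q R) (Y : Matrix q m R)
    (h : ∀ (f : m → p) (g : m → q), d ∣ (A.submatrix f g).det) : d ∣ (X * A * Y).det := by
  rw [Matrix.mul_assoc]
  refine dvd_det_mul_of_forall_submatrix X (A * Y) fun f => ?_
  have hsub : (A * Y).submatrix f id = A.submatrix f id * Y := rfl
  rw [hsub, ← det_transpose, transpose_mul]
  refine dvd_det_mul_of_forall_submatrix _ _ fun g => ?_
  rw [← det_transpose]
  exact h f g

theorem dvd_det_submatrix_of_forall_strictMono {α β : Type*} [LinearOrder α] [LinearOrder β]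
    {i : ℕ} {d : R} (A : Matrix α β R)
    (h : ∀ (f : Fin i → α) (g : Fin i → β), StrictMono f → StrictMono g →
      d ∣ (A.submatrix f g).det) (f : Fin i → α) (g : Fin i → β) :
    d ∣ (A.submatrix f g).det := by
  by_cases hf : f.Injective
  swap
  · obtain ⟨a, b, hab, hne⟩ := Function.not_injective_iff.mp hf
    rw [det_zero_of_row_eq hne (by ext c; simp [hab])]
    exact dvd_zero d
  by_cases hg : g.Injective
  swap
  · obtain ⟨a, b, hab, hne⟩ := Function.not_injective_iff.mp hg
    rw [det_zero_of_column_eq hne (fun c => by simp [hab])]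
    exact dvd_zero d
  have key := h (f ∘ Tuple.sort f) (g ∘ Tuple.sort g)
    ((Tuple.monotone_sort f).strictMono_of_injective (hf.comp (Equiv.injective _)))
    ((Tuple.monotone_sort g).strictMono_of_injective (hg.comp (Equiv.injective _)))
  have hsub : A.submatrix (f ∘ Tuple.sort f) (g ∘ Tuple.sort g) =
      ((A.submatrix f g).submatrix (Tuple.sort f) id).submatrix id (Tuple.sort g) := rfl
  have hunit (σ : Equiv.Perm (Fin i)) : IsUnit (((Equiv.Perm.sign σ : ℤˣ) : ℤ) : R) :=
    (Units.isUnit _).map (Int.castRingHom R)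
  rwa [hsub, det_permute', det_permute, (hunit _).dvd_mul_left, (hunit _).dvd_mul_left] at key

theorem det_submatrix_diagonal [DecidableEq p] (x : p → R) (f g : m → p) :
    ((diagonal x).submatrix f g).det =
      (∏ k, x (f k)) * ((1 : Matrix p p R).submatrix f g).det := by
  rw [← det_mul_column]
  congr 1
  ext k l
  simp [diagonal_apply, one_apply]

theorem det_updateRow_diagonal_const (x : m → R) (c : R) (k₀ : m) :
    ((diagonal x).updateRow k₀ fun _ => c).det = c * ∏ k ∈ Finset.univ.erase k₀, x k := by
  rw [← cramer_transpose_apply, cramer_eq_adjugate_mulVec, diagonal_transpose, adjugate_diagonal,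
    mulVec_diagonal, mul_comm]

theorem det_updateRow_diagonal_add_const (x : m → R) (c : R) (k₀ : m) (s : Finset m) :
    ((of fun k l => (if k = l then x k else 0) + if k ∈ s then c else 0).updateRow k₀
      fun _ => c).det = c * ∏ k ∈ Finset.univ.erase k₀, x k := by
  rw [← det_updateRow_diagonal_const]
  refine det_eq_of_forall_row_eq_smul_add_const (fun k => if k ∈ s ∧ k ≠ k₀ then 1 else 0) k₀
    (by simp) fun k l => ?_
  by_cases hk : k = k₀
  · subst hk; simp
  · by_cases hs : k ∈ s <;> simp [hk, hs, diagonal_apply]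

theorem dvd_det_diagonal_add_const_sub_prod {d : R} (x : m → R) (c : R)
    (h : ∀ k₀, d ∣ c * ∏ k ∈ Finset.univ.erase k₀, x k) (s : Finset m) :
    d ∣ (of fun k l => (if k = l then x k else 0) + if k ∈ s then c else 0).det - ∏ k, x k := by
  induction s using Finset.induction_on with
  | empty =>
    have hdiag : (of fun k l => (if k = l then x k else 0) + if k ∈ (∅ : Finset m) then c else 0) =
        diagonal x := by
      ext k l; simp [diagonal_apply]
    rw [hdiag, det_diagonal, sub_self]
    exact dvd_zero d
  | insert k₀ s hk₀ ih =>
    set A := of fun k l => (if k = l then x k else 0) + if k ∈ s then c else 0 with hA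
    have hadd : (of fun k l => (if k = l then x k else 0) + if k ∈ insert k₀ s then c else 0) =
        A.updateRow k₀ (A k₀ + fun _ => c) := by
      ext k l
      by_cases hk : k = k₀
      · subst hk; simp [hA, hk₀]
      · simp [hA, hk]
    rw [hadd, det_updateRow_add, updateRow_eq_self, hA, det_updateRow_diagonal_add_const,
      add_sub_right_comm]
    exact dvd_add ih (h k₀)

end Matrix

open Matrix

/-- The signed incidence matrix of a directed path on `N` vertices, with a zero row appended. -/
def pathIncidence (N : ℕ) : Matrix (Fin N) (Fin N) ℤ :=
  of fun r c => if (r : ℕ) + 1 < N then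
    (if (c : ℕ) = r + 1 then 1 else 0) - (if (c : ℕ) = r then 1 else 0) else 0

/-- The identity matrix of size `N - 1` with a row of `-1` and a zero column appended. -/
def coneIncidence (N : ℕ) : Matrix (Fin N) (Fin N) ℤ :=
  of fun r c => if (c : ℕ) + 1 < N then
    (if r = c then 1 else 0) - (if (r : ℕ) + 1 = N then 1 else 0) else 0

theorem pathIncidence_mul_apply {N : ℕ} (A : Matrix (Fin N) (Fin N) ℤ) (r c : Fin N)
    (hr : (r : ℕ) + 1 < N) :
    (pathIncidence N * A) r c = A ⟨r + 1, hr⟩ c - A r c := by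
  have h1 (l : Fin N) : ((l : ℕ) = r + 1) ↔ l = ⟨r + 1, hr⟩ := by simp [Fin.ext_iff]
  have h2 (l : Fin N) : ((l : ℕ) = r) ↔ l = r := by simp [Fin.ext_iff]
  simp [mul_apply, pathIncidence, hr, sub_mul, Finset.sum_sub_distrib, h1, h2]

theorem pretzelM'_eq_mul (N : ℕ) (n : ℕ → ℤ) :
    pretzelM' N n =
      pathIncidence N * diagonal (fun k : Fin N => n (k + 1)) * coneIncidence N := by
  ext r c
  rw [Matrix.mul_assoc]
  by_cases hr : (r : ℕ) + 1 < N
  · rw [pathIncidence_mul_apply _ _ _ hr, diagonal_mul, diagonal_mul]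
    simp only [pretzelM', coneIncidence, of_apply, Fin.ext_iff]
    split_ifs <;> first | omega | grind
  · have hz : pathIncidence N r = 0 := by ext; simp [pathIncidence, hr]
    simp [mul_apply, hz, pretzelM', show ¬ (r : ℕ) + 2 < N by omega, show (r : ℕ) + 2 ≠ N by omega]

/-- The matrix whose left multiplication replaces each row other than the last by minus the sum
of the rows from it to the penultimate one. -/
def negTailSum (N : ℕ) : Matrix (Fin N) (Fin N) ℤ :=
  of fun r k => if (r : ℕ) ≤ k ∧ (k : ℕ) + 1 < N then -1 else 0

theorem negTailSum_mul_pathIncidence_mul_apply {N : ℕ} (A : Matrix (Fin N) (Fin N) ℤ)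
    (r c : Fin N) :
    (negTailSum N * (pathIncidence N * A)) r c = A r c - A ⟨N - 1, by have := r.isLt; omega⟩ c := by
  obtain ⟨a, ha⟩ : ∃ a : ℕ → ℤ, ∀ k : Fin N, a k = A k c :=
    ⟨fun k => if h : k < N then A ⟨k, h⟩ c else 0, fun k => by simp⟩
  have hterm (k : Fin N) : negTailSum N r k * (pathIncidence N * A) k c =
      if (r : ℕ) ≤ k ∧ (k : ℕ) + 1 < N then -(a (k + 1) - a k) else 0 := by
    by_cases hk : (k : ℕ) + 1 < N
    · have := ha ⟨k + 1, hk⟩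
      simp only at this
      rw [pathIncidence_mul_apply _ _ _ hk, ha, this]
      rw [negTailSum, of_apply, ite_mul, neg_one_mul, zero_mul]
    · simp [negTailSum, hk]
  rw [Matrix.mul_apply, Finset.sum_congr rfl fun k _ => hterm k,
    Fin.sum_univ_eq_sum_range
      (fun k => if (r : ℕ) ≤ k ∧ k + 1 < N then -(a (k + 1) - a k) else 0) N,
    ← Finset.sum_filter]
  have hIco : (Finset.range N).filter (fun k => (r : ℕ) ≤ k ∧ k + 1 < N) =
      Finset.Ico (r : ℕ) (N - 1) := by
    ext k; simp; omega
  rw [hIco, Finset.sum_neg_distrib, Finset.sum_Ico_sub _ (by omega), ← ha r,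
    ← ha ⟨N - 1, by have := r.isLt; omega⟩]
  ring

theorem negTailSum_mul_pretzelM'_apply {N : ℕ} (n : ℕ → ℤ) (r c : Fin N)
    (hr : (r : ℕ) + 1 < N) (hc : (c : ℕ) + 1 < N) :
    (negTailSum N * pretzelM' N n) r c = (if r = c then n (r + 1) else 0) + n N := by
  rw [pretzelM'_eq_mul, Matrix.mul_assoc, negTailSum_mul_pathIncidence_mul_apply, diagonal_mul,
    diagonal_mul]
  have h1 : N - 1 + 1 = N := by omega
  have h2 : (⟨N - 1, by have := r.isLt; omega⟩ : Fin N) ≠ c := by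
    simp only [ne_eq, Fin.ext_iff]; omega
  simp [coneIncidence, hc, hr.ne, h1, h2]

theorem dvd_det_submatrix_pretzelM' {N i : ℕ} (n : ℕ → ℤ) {d : ℤ}
    (h : ∀ T ∈ (Finset.Icc 1 N).powersetCard i, d ∣ ∏ s ∈ T, n s) (f g : Fin i → Fin N) :
    d ∣ ((pretzelM' N n).submatrix f g).det := by
  have hsub : (pretzelM' N n).submatrix f g = (pathIncidence N).submatrix f id *
      diagonal (fun k : Fin N => n (k + 1)) * (coneIncidence N).submatrix id g := by
    rw [pretzelM'_eq_mul]
    rfl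
  rw [hsub]
  refine dvd_det_mul_mul_of_forall_submatrix _ _ _ fun f g => ?_
  rw [det_submatrix_diagonal]
  by_cases hf : f.Injective
  · have hinj : Function.Injective fun k => (f k : ℕ) + 1 := fun a b hab =>
      hf (Fin.ext (Nat.succ_injective hab))
    have hprod := h (Finset.univ.image fun k => (f k : ℕ) + 1) (by
      rw [Finset.mem_powersetCard, Finset.card_image_of_injective _ hinj, Finset.card_fin]
      refine ⟨fun t ht => ?_, rfl⟩
      obtain ⟨k, -, rfl⟩ := Finset.mem_image.mp ht
      exact Finset.mem_Icc.mpr ⟨by omega, (f k).isLt⟩)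
    rw [Finset.prod_image hinj.injOn] at hprod
    exact hprod.mul_right _
  · obtain ⟨a, b, hab, hne⟩ := Function.not_injective_iff.mp hf
    rw [det_zero_of_row_eq hne (by ext c; rw [submatrix_apply, submatrix_apply, hab]), mul_zero]
    exact dvd_zero d

section

variable {N i : ℕ} {n : ℕ → ℤ} {d : ℤ}

theorem dvd_det_of_forall_submatrix_pretzelM'
    (h : ∀ f g : Fin i → Fin N, d ∣ ((pretzelM' N n).submatrix f g).det) {f g : Fin i → Fin N}
    (hf : ∀ k, (f k : ℕ) + 1 < N) (hg : ∀ k, (g k : ℕ) + 1 < N) :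
    d ∣ (of fun k l => (if f k = g l then n (f k + 1) else 0) + n N).det := by
  have hmat : (of fun k l => (if f k = g l then n (f k + 1) else 0) + n N) =
      (negTailSum N).submatrix f id * pretzelM' N n *
        (1 : Matrix (Fin N) (Fin N) ℤ).submatrix id g := by
    have hsub : (negTailSum N).submatrix f id * pretzelM' N n *
        (1 : Matrix (Fin N) (Fin N) ℤ).submatrix id g =
        (negTailSum N * pretzelM' N n * 1).submatrix f g := rfl
    ext k l
    rw [hsub, Matrix.mul_one, submatrix_apply, negTailSum_mul_pretzelM'_apply n _ _ (hf k) (hg l),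
      of_apply]
  rw [hmat]
  exact dvd_det_mul_mul_of_forall_submatrix _ _ _ h

theorem dvd_mul_prod_erase_of_forall_submatrix_pretzelM' (hi : i + 2 ≤ N)
    (h : ∀ f g : Fin i → Fin N, d ∣ ((pretzelM' N n).submatrix f g).det) {f : Fin i → Fin N}
    (hinj : f.Injective) (hf : ∀ k, (f k : ℕ) + 1 < N) (k₀ : Fin i) :
    d ∣ n N * ∏ k ∈ Finset.univ.erase k₀, n (f k + 1) := by
  obtain ⟨b, hb, hbf⟩ : ∃ b ∈ Finset.range (N - 1), b ∉ Finset.univ.image fun k => (f k : ℕ) := by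
    refine Finset.exists_mem_notMem_of_card_lt_card ?_
    refine Finset.card_image_le.trans_lt ?_
    simp; omega
  have hbN : b + 1 < N := by have := Finset.mem_range.mp hb; omega
  have hne (k : Fin i) : f k ≠ ⟨b, by omega⟩ := fun hk =>
    hbf (Finset.mem_image.mpr ⟨k, Finset.mem_univ k, by rw [hk]⟩)
  have key := dvd_det_of_forall_submatrix_pretzelM' h hf
    (g := Function.update f k₀ ⟨b, by omega⟩) (fun k => by
      by_cases hk : k = k₀
      · subst hk; simpa using hbN
      · simpa [hk] using hf k)
  rw [← det_updateRow_diagonal_add_const (fun k => n (f k + 1)) (n N) k₀ Finset.univ]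
  convert key using 2
  ext k l
  by_cases hl : l = k₀
  · subst hl
    by_cases hk : k = l <;> simp [hk, hne]
  · by_cases hk : k = k₀
    · subst hk; simp [hl, hinj.eq_iff, Ne.symm hl]
    · simp [hl, hk, hinj.eq_iff]

theorem dvd_prod_of_forall_submatrix_pretzelM' (hi : i + 2 ≤ N)
    (h : ∀ f g : Fin i → Fin N, d ∣ ((pretzelM' N n).submatrix f g).det) {f : Fin i → Fin N}
    (hinj : f.Injective) (hf : ∀ k, (f k : ℕ) + 1 < N) :
    d ∣ ∏ k, n (f k + 1) := by
  have hdet := dvd_det_of_forall_submatrix_pretzelM' h hf hf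
  have hsub := dvd_det_diagonal_add_const_sub_prod (fun k => n (f k + 1)) (n N)
    (dvd_mul_prod_erase_of_forall_submatrix_pretzelM' hi h hinj hf) Finset.univ
  simp only [hinj.eq_iff] at hdet
  simp only [Finset.mem_univ, if_true] at hsub
  exact (dvd_sub_right hdet).mp hsub

theorem exists_injective_image_eq {T : Finset ℕ} (hT : T ⊆ Finset.Icc 1 (N - 1))
    (hcard : T.card = i) :
    ∃ f : Fin i → Fin N, f.Injective ∧ (∀ k, (f k : ℕ) + 1 < N) ∧
      Finset.univ.image (fun k => (f k : ℕ) + 1) = T := by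
  have hmem (k : Fin i) := Finset.mem_Icc.mp (hT (T.orderEmbOfFin_mem hcard k))
  have hsucc (k : Fin i) : T.orderEmbOfFin hcard k - 1 + 1 = T.orderEmbOfFin hcard k :=
    Nat.sub_add_cancel (hmem k).1
  refine ⟨fun k => ⟨T.orderEmbOfFin hcard k - 1, by have := hmem k; omega⟩, fun a b hab => ?_,
    fun k => ?_, ?_⟩
  · have := Fin.ext_iff.mp hab
    simp only at this
    exact (T.orderEmbOfFin hcard).injective (by rw [← hsucc a, ← hsucc b, this])
  · have := hmem k
    simp only
    omega
  · simp only [hsucc]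
    exact Finset.image_orderEmbOfFin_univ T hcard

theorem dvd_prod_powersetCard_of_forall_submatrix_pretzelM' (hi : i + 2 ≤ N)
    (h : ∀ f g : Fin i → Fin N, d ∣ ((pretzelM' N n).submatrix f g).det) {T : Finset ℕ}
    (hT : T ∈ (Finset.Icc 1 N).powersetCard i) : d ∣ ∏ s ∈ T, n s := by
  obtain ⟨hsub, hcard⟩ := Finset.mem_powersetCard.mp hT
  have hlt {s : ℕ} (hs : s ∈ T) (hsN : s ≠ N) : s ∈ Finset.Icc 1 (N - 1) := by
    have := Finset.mem_Icc.mp (hsub hs)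
    exact Finset.mem_Icc.mpr (by omega)
  by_cases hN : N ∈ T
  · obtain ⟨b, hb, hbT⟩ : ∃ b ∈ Finset.Icc 1 (N - 1), b ∉ T :=
      Finset.exists_mem_notMem_of_card_lt_card (by simp; omega)
    have hbT' : b ∉ T.erase N := fun hb' => hbT (Finset.mem_of_mem_erase hb')
    obtain ⟨f, hinj, hf, himg⟩ := exists_injective_image_eq (N := N) (i := i)
      (T := insert b (T.erase N))
      (Finset.insert_subset hb fun s hs =>
        hlt (Finset.mem_of_mem_erase hs) (Finset.ne_of_mem_erase hs))
      (by
        rw [Finset.card_insert_of_notMem hbT', Finset.card_erase_of_mem hN, hcard]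
        have := Finset.card_pos.mpr ⟨N, hN⟩
        omega)
    have hinj' : Function.Injective fun k => (f k : ℕ) + 1 := fun a b hab =>
      hinj (Fin.ext (Nat.succ_injective hab))
    obtain ⟨k₀, -, hk₀⟩ := Finset.mem_image.mp (himg ▸ Finset.mem_insert_self b (T.erase N))
    have key := dvd_mul_prod_erase_of_forall_submatrix_pretzelM' hi h hinj hf k₀
    rw [← Finset.prod_image (f := n) (g := fun k => (f k : ℕ) + 1) hinj'.injOn,
      Finset.image_erase hinj', himg, hk₀, Finset.erase_insert hbT'] at key
    rwa [Finset.mul_prod_erase _ _ hN] at key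
  · obtain ⟨f, hinj, hf, rfl⟩ := exists_injective_image_eq (N := N)
      (fun s hs => hlt hs fun hsN => hN (hsN ▸ hs)) hcard
    rw [Finset.prod_image fun a _ b _ hab => hinj (Fin.ext (Nat.succ_injective hab))]
    exact dvd_prod_of_forall_submatrix_pretzelM' hi h hinj hf

end

open Classical in
/-- For `N > 2`, positive integers `n 1, …, n N` and `1 ≤ i ≤ N-2`,
the greatest common divisor of all `i`-rowed minors of `M'(n 1, …, n N)` (determinants
of submatrices given by strictly increasing choices of `i` rows and `i` columns)
equals the greatest common divisor of all products `n s₁ * ⋯ * n sᵢ` over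
`1 ≤ s₁ < ⋯ < sᵢ ≤ N` (i.e. over all `i`-element subsets of `{1, …, N}`);
gcds are taken as nonnegative integers. -/
theorem pretzelM'_gcd_minors (N : ℕ) (hN : 2 < N) (n : ℕ → ℤ)
    (hn : ∀ k, 1 ≤ k → k ≤ N → 0 < n k) (i : ℕ) (hi1 : 1 ≤ i) (hi2 : i ≤ N - 2) :
    (((Finset.univ : Finset ((Fin i → Fin N) × (Fin i → Fin N))).filter
        (fun p => StrictMono p.1 ∧ StrictMono p.2)).gcd
      (fun p => ((pretzelM' N n).submatrix p.1 p.2).det)) =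
    ((Finset.Icc 1 N).powersetCard i).gcd (fun T => ∏ s ∈ T, n s) := by
  refine dvd_antisymm_of_normalize_eq Finset.normalize_gcd Finset.normalize_gcd ?_ ?_
  · refine Finset.dvd_gcd fun T hT =>
      dvd_prod_powersetCard_of_forall_submatrix_pretzelM' (by omega) ?_ hT
    refine dvd_det_submatrix_of_forall_strictMono _ fun f g hf hg => ?_
    exact Finset.gcd_dvd (f := fun p : (Fin i → Fin N) × (Fin i → Fin N) =>
      ((pretzelM' N n).submatrix p.1 p.2).det) (b := (f, g)) (by simp [hf, hg])
  · exact Finset.dvd_gcd fun p _ =>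
      dvd_det_submatrix_pretzelM' n (fun T hT => Finset.gcd_dvd (f := fun T => ∏ s ∈ T, n s) hT) p.1 p.2
end

section
/- Let N > 2 be an integer and n_1, …, n_N positive integers. The greatest common divisor of all (N−1)-rowed minors of the matrix M'(n_1, …, n_N) equals Σ_{1 ≤ s_1 < s_2 < ⋯ < s_{N−1} ≤ N} n_{s_1}·n_{s_2}·⋯·n_{s_{N−1}}, i.e. the sum over s = 1, …, N of the products ∏_{j≠s} n_j. -/
open Finset in
theorem sum_prod_erase_insert (n : ℕ → ℤ) {b : ℕ} {S : Finset ℕ} (hb : b ∉ S) :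
    ∑ s ∈ insert b S, ∏ j ∈ (insert b S).erase s, n j =
      ∏ j ∈ S, n j + n b * ∑ s ∈ S, ∏ j ∈ S.erase s, n j := by
  rw [sum_insert hb, erase_insert hb, mul_sum]
  congr 1
  refine sum_congr rfl fun s hs => ?_
  have hne : b ≠ s := fun h => hb (h ▸ hs)
  rw [erase_insert_of_ne hne, prod_insert fun h => hb (mem_of_mem_erase h)]

/-- The square matrix whose row `k` has `-n (p + k)` on the diagonal and `n (p + k + 1)` to its
right, except for the last row, which is constant `-x` with `-n (p + m)` added on the diagonal. -/
def pretzelCore (n : ℕ → ℤ) (x : ℤ) (p m : ℕ) : Matrix (Fin (m + 1)) (Fin (m + 1)) ℤ :=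
  Matrix.of fun r c =>
    if (r : ℕ) = m then (if (c : ℕ) = m then -x - n (p + m) else -x)
    else if (c : ℕ) = r then -n (p + r)
    else if (c : ℕ) = r + 1 then n (p + r + 1)
    else 0

theorem pretzelCore_submatrix_succ (n : ℕ → ℤ) (x : ℤ) (p m : ℕ) :
    (pretzelCore n x p (m + 1)).submatrix Fin.succ Fin.succ = pretzelCore n x (p + 1) m := by
  ext r c
  simp [pretzelCore, add_assoc, add_comm 1]

theorem det_pretzelCore_submatrix_castSucc (n : ℕ → ℤ) (x : ℤ) (p m : ℕ) :
    ((pretzelCore n x p (m + 1)).submatrix Fin.castSucc Fin.succ).det =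
      ∏ j ∈ Finset.Icc (p + 1) (p + 1 + m), n j := by
  rw [Matrix.det_of_isLowerTriangular]
  · have h : Finset.Icc (p + 1) (p + 1 + m) = Finset.Ico (p + 1) (p + 1 + (m + 1)) := by
      ext; simp; omega
    rw [h, Finset.prod_Ico_eq_prod_range, Nat.add_sub_cancel_left,
      ← Fin.prod_univ_eq_prod_range (fun k => n (p + 1 + k))]
    refine Finset.prod_congr rfl fun i _ => ?_
    have := i.isLt
    simp [pretzelCore, this.ne, add_right_comm]
  · intro i j hij
    have hij : (i : ℕ) < j := hij
    have := j.isLt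
    simp only [pretzelCore, Matrix.submatrix_apply, Matrix.of_apply, Fin.val_castSucc,
      Fin.val_succ]
    split_ifs <;> first | rfl | omega

theorem det_pretzelCore (n : ℕ → ℤ) (x : ℤ) (p m : ℕ) :
    (pretzelCore n x p m).det = (-1) ^ (m + 1) *
      (∏ j ∈ Finset.Icc p (p + m), n j +
        x * ∑ s ∈ Finset.Icc p (p + m), ∏ j ∈ (Finset.Icc p (p + m)).erase s, n j) := by
  induction m generalizing p with
  | zero =>
    simp [pretzelCore]
    ring
  | succ m ih =>
    have hIcc : Finset.Icc p (p + (m + 1)) = insert p (Finset.Icc (p + 1) (p + 1 + m)) := by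
      ext; simp; omega
    have hp : p ∉ Finset.Icc (p + 1) (p + 1 + m) := by simp
    rw [hIcc, sum_prod_erase_insert n hp, Finset.prod_insert hp, Matrix.det_succ_column_zero,
      Fin.sum_univ_succ, Fin.sum_univ_castSucc, Finset.sum_eq_zero, Fin.succAbove_zero,
      pretzelCore_submatrix_succ, ih, Fin.succ_last, Fin.succAbove_last,
      det_pretzelCore_submatrix_castSucc]
    · simp [pretzelCore]
      ring
    · intro i _
      have := i.isLt
      simp [pretzelCore, this.ne]

theorem pretzelM'_submatrix_castSucc (n : ℕ → ℤ) (m : ℕ) :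
    (pretzelM' (m + 2) n).submatrix Fin.castSucc Fin.castSucc =
      pretzelCore n (n (m + 2)) 1 m := by
  ext r c
  have := r.isLt
  have := c.isLt
  simp only [pretzelM', pretzelCore, Matrix.submatrix_apply, Matrix.of_apply, Fin.val_castSucc]
  have h1 : m + 2 - 1 = 1 + m := by omega
  have h2 : (r : ℕ) + 2 = 1 + r + 1 := by omega
  rw [h1, h2, add_comm (r : ℕ) 1]
  split_ifs <;> first | rfl | omega

theorem pretzelM'_last_row (n : ℕ → ℤ) (m : ℕ) (c : Fin (m + 2)) :
    pretzelM' (m + 2) n (Fin.last (m + 1)) c = 0 := by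
  simp [pretzelM']

theorem pretzelM'_last_column (n : ℕ → ℤ) (m : ℕ) (r : Fin (m + 2)) :
    pretzelM' (m + 2) n r (Fin.last (m + 1)) = 0 := by
  simp only [pretzelM', Matrix.of_apply, Fin.val_last]
  split_ifs <;> first | rfl | omega

theorem StrictMono.eq_castSucc_of_forall_ne_last {k : ℕ} {f : Fin k → Fin (k + 1)}
    (hf : StrictMono f) (h : ∀ i, f i ≠ Fin.last k) : f = Fin.castSucc := by
  have hg : StrictMono fun i => (f i).castPred (h i) := fun i j hij => by
    simpa using hf hij
  funext i
  have := congrFun (hg.range_inj (g := id) strictMono_id |>.1 (by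
    rw [Set.range_id, Set.range_eq_univ]
    exact Finite.surjective_of_injective hg.injective)) i
  simpa [Fin.castPred_eq_iff_eq_castSucc] using this

theorem associated_det_pretzelM'_submatrix_castSucc (n : ℕ → ℤ) (m : ℕ) :
    Associated ((pretzelM' (m + 2) n).submatrix Fin.castSucc Fin.castSucc).det
      (∑ s ∈ Finset.Icc 1 (m + 2), ∏ j ∈ (Finset.Icc 1 (m + 2)).erase s, n j) := by
  have hIcc : Finset.Icc 1 (m + 2) = insert (m + 2) (Finset.Icc 1 (1 + m)) := by
    ext; simp; omega
  have hm : m + 2 ∉ Finset.Icc 1 (1 + m) := by simp; omega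
  rw [pretzelM'_submatrix_castSucc, det_pretzelCore, hIcc, sum_prod_erase_insert n hm]
  exact associated_unit_mul_left _ _ (isUnit_one.neg.pow _)

open Classical in
/-- For `N > 2` and positive integers `n 1, …, n N`, the greatest
common divisor of all `(N-1)`-rowed minors of `M'(n 1, …, n N)` equals
`∑_{s=1}^{N} ∏_{j ≠ s} n j`, the sum over all strictly increasing choices
`1 ≤ s₁ < ⋯ < s_{N-1} ≤ N` of the products `n s₁ * ⋯ * n s_{N-1}`;
gcds are taken as nonnegative integers. -/
theorem pretzelM'_gcd_maximal_minors (N : ℕ) (hN : 2 < N) (n : ℕ → ℤ)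
    (hn : ∀ k, 1 ≤ k → k ≤ N → 0 < n k) :
    (((Finset.univ : Finset ((Fin (N - 1) → Fin N) × (Fin (N - 1) → Fin N))).filter
        (fun p => StrictMono p.1 ∧ StrictMono p.2)).gcd
      (fun p => ((pretzelM' N n).submatrix p.1 p.2).det)) =
    ∑ s ∈ Finset.Icc 1 N, ∏ j ∈ (Finset.Icc 1 N).erase s, n j := by
  obtain ⟨m, rfl⟩ : ∃ m, N = m + 2 := ⟨N - 2, by omega⟩
  have hassoc := associated_det_pretzelM'_submatrix_castSucc n m
  have hnonneg : 0 ≤ ∑ s ∈ Finset.Icc 1 (m + 2), ∏ j ∈ (Finset.Icc 1 (m + 2)).erase s, n j :=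
    Finset.sum_nonneg fun s _ => Finset.prod_nonneg fun j hj => by
      have hj := Finset.mem_Icc.1 (Finset.mem_of_mem_erase hj)
      exact (hn j hj.1 hj.2).le
  refine dvd_antisymm_of_normalize_eq Finset.normalize_gcd (Int.normalize_of_nonneg hnonneg) ?_ ?_
  · refine dvd_trans (Finset.gcd_dvd (b := (Fin.castSucc, Fin.castSucc)) ?_) hassoc.dvd
    simpa using Fin.strictMono_castSucc
  · refine Finset.dvd_gcd fun p hp => ?_
    obtain ⟨hp1, hp2⟩ := (Finset.mem_filter.1 hp).2
    by_cases h1 : ∃ i, p.1 i = Fin.last (m + 1)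
    · obtain ⟨i, hi⟩ := h1
      rw [Matrix.det_eq_zero_of_row_eq_zero i fun j => by
        rw [Matrix.submatrix_apply, hi, pretzelM'_last_row]]
      exact dvd_zero _
    by_cases h2 : ∃ i, p.2 i = Fin.last (m + 1)
    · obtain ⟨i, hi⟩ := h2
      rw [Matrix.det_eq_zero_of_column_eq_zero i fun j => by
        rw [Matrix.submatrix_apply, hi, pretzelM'_last_column]]
      exact dvd_zero _
    push Not at h1 h2
    rw [StrictMono.eq_castSucc_of_forall_ne_last hp1 h1,
      StrictMono.eq_castSucc_of_forall_ne_last hp2 h2]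
    exact hassoc.symm.dvd
end

section
/- Let N > 2 be an integer and n_1, …, n_N positive integers. Define Δ_i, for 1 ≤ i ≤ N−2, as the greatest common divisor of all products n_{s_1}·⋯·n_{s_i} with 1 ≤ s_1 < ⋯ < s_i ≤ N, and define Δ_{N−1} = Σ_{1 ≤ s_1 < ⋯ < s_{N−1} ≤ N} n_{s_1}·⋯·n_{s_{N−1}}. Then there exist N×N integer matrices U and V of determinant ±1 and integers d_1, …, d_{N−1} such that U · P(n_1, …, n_N) · V is the diagonal matrix with diagonal entries d_1, d_2, …, d_{N−1}, 0, where d_1 = Δ_1 and d_i · Δ_{i−1} = Δ_i for every 2 ≤ i ≤ N−1. -/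
open Matrix

/-- Two square integer matrices are unimodularly equivalent. -/
def UnimodularEquiv {ι : Type*} [Fintype ι] [DecidableEq ι] (A B : Matrix ι ι ℤ) : Prop :=
  ∃ U V : Matrix ι ι ℤ, IsUnit U.det ∧ IsUnit V.det ∧ U * A * V = B

namespace UnimodularEquiv

variable {ι κ : Type*} [Fintype ι] [DecidableEq ι] [Fintype κ] [DecidableEq κ]
  {A B C : Matrix ι ι ℤ}

theorem refl (A : Matrix ι ι ℤ) : UnimodularEquiv A A := ⟨1, 1, by simp, by simp, by simp⟩

theorem trans (h₁ : UnimodularEquiv A B) (h₂ : UnimodularEquiv B C) : UnimodularEquiv A C := by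
  obtain ⟨U, V, hU, hV, rfl⟩ := h₁
  obtain ⟨U', V', hU', hV', rfl⟩ := h₂
  refine ⟨U' * U, V * V', ?_, ?_, by simp only [Matrix.mul_assoc]⟩
  · rw [det_mul]; exact hU'.mul hU
  · rw [det_mul]; exact hV.mul hV'

theorem symm (h : UnimodularEquiv A B) : UnimodularEquiv B A := by
  obtain ⟨U, V, hU, hV, rfl⟩ := h
  refine ⟨U⁻¹, V⁻¹, isUnit_nonsing_inv_det _ hU, isUnit_nonsing_inv_det _ hV, ?_⟩
  rw [Matrix.mul_assoc U, nonsing_inv_mul_cancel_left _ _ hU, mul_nonsing_inv_cancel_right _ _ hV]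

theorem submatrix_equiv (h : UnimodularEquiv A B) (e : κ ≃ ι) :
    UnimodularEquiv (A.submatrix e e) (B.submatrix e e) := by
  obtain ⟨U, V, hU, hV, rfl⟩ := h
  refine ⟨U.submatrix e e, V.submatrix e e, ?_, ?_, ?_⟩
  · rwa [det_submatrix_equiv_self]
  · rwa [det_submatrix_equiv_self]
  · simp only [submatrix_mul_equiv]

theorem mul_left {U : Matrix ι ι ℤ} (hU : IsUnit U.det) (A : Matrix ι ι ℤ) :
    UnimodularEquiv A (U * A) := ⟨U, 1, hU, by simp, by simp⟩

theorem mul_right {V : Matrix ι ι ℤ} (hV : IsUnit V.det) (A : Matrix ι ι ℤ) :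
    UnimodularEquiv A (A * V) := ⟨1, V, by simp, hV, by simp⟩

theorem permute (A : Matrix ι ι ℤ) (σ τ : Equiv.Perm ι) :
    UnimodularEquiv A (A.submatrix σ τ) := by
  refine ⟨(1 : Matrix ι ι ℤ).submatrix σ id, (1 : Matrix ι ι ℤ).submatrix id τ, ?_, ?_, ?_⟩
  · rw [det_permute]
    simp
  · rw [det_permute']
    simp
  · ext i j
    simp [Matrix.mul_apply, Matrix.one_apply]

theorem dvd_of_forall_dvd (h : UnimodularEquiv A B) {a : ℤ} (ha : ∀ i j, a ∣ A i j) (i j : ι) :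
    a ∣ B i j := by
  obtain ⟨U, V, -, -, rfl⟩ := h
  simp only [Matrix.mul_apply]
  exact Finset.dvd_sum fun k _ => Dvd.dvd.mul_right
    (Finset.dvd_sum fun l _ => Dvd.dvd.mul_left (ha _ _) _) _

/-- A nonzero entry of least absolute value among all entries of all matrices equivalent to `A`
divides its row. -/
theorem dvd_row_of_minimal {a : ℕ}
    (hmin : ∀ B, UnimodularEquiv A B → ∀ i j, B i j ≠ 0 → a ≤ (B i j).natAbs)
    (hB : UnimodularEquiv A B) {i j : ι} (h0 : B i j ≠ 0) (ha : (B i j).natAbs = a) (k : ι) :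
    B i j ∣ B i k := by
  by_cases hk : j = k
  · rw [hk]
  by_contra hdvd
  have h1 := hmin _ (hB.trans (mul_right (V := transvection j k (-(B i k / B i j)))
    (by simp [det_transvection_of_ne _ _ hk]) B)) i k
  rw [mul_transvection_apply_same] at h1
  have h2 : B i k + -(B i k / B i j) * B i j = B i k % B i j := by
    rw [Int.emod_def]; ring
  rw [h2] at h1
  have h3 := h1 fun h => hdvd (Int.dvd_of_emod_eq_zero h)
  have h4 := Int.emod_nonneg (B i k) h0
  have h5 := Int.emod_lt_abs (B i k) h0
  rw [Int.abs_eq_natAbs] at h5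
  omega

theorem transpose (h : UnimodularEquiv A B) : UnimodularEquiv Aᵀ Bᵀ := by
  obtain ⟨U, V, hU, hV, rfl⟩ := h
  exact ⟨Vᵀ, Uᵀ, by rwa [det_transpose], by rwa [det_transpose],
    by simp [Matrix.mul_assoc]⟩

theorem dvd_col_of_minimal {a : ℕ}
    (hmin : ∀ B, UnimodularEquiv A B → ∀ i j, B i j ≠ 0 → a ≤ (B i j).natAbs)
    (hB : UnimodularEquiv A B) {i j : ι} (h0 : B i j ≠ 0) (ha : (B i j).natAbs = a) (k : ι) :
    B i j ∣ B k j :=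
  dvd_row_of_minimal (A := Aᵀ) (B := Bᵀ)
    (fun C hC i j h => hmin Cᵀ (by simpa using hC.transpose) j i h) hB.transpose h0 ha k

/-- A nonzero matrix is equivalent to one having a nonzero entry at a prescribed position that
divides all the entries. -/
theorem exists_dvd_entries (hA : A ≠ 0) (i₀ : ι) :
    ∃ B, UnimodularEquiv A B ∧ ∀ i j, B i₀ i₀ ∣ B i j := by
  classical
  have hex : ∃ a : ℕ, ∃ B, UnimodularEquiv A B ∧ ∃ i j, B i j ≠ 0 ∧ (B i j).natAbs = a := by
    obtain ⟨i, j, hij⟩ : ∃ i j, A i j ≠ 0 := by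
      by_contra! h
      exact hA (by ext i j; exact h i j)
    exact ⟨_, A, refl A, i, j, hij, rfl⟩
  obtain ⟨B, hB, p, q, h0, ha⟩ := Nat.find_spec hex
  have hmin : ∀ B, UnimodularEquiv A B → ∀ i j, B i j ≠ 0 → Nat.find hex ≤ (B i j).natAbs :=
    fun B hB i j h => Nat.find_min' hex ⟨B, hB, i, j, h, rfl⟩
  refine ⟨B.submatrix (Equiv.swap i₀ p) (Equiv.swap i₀ q), hB.trans (permute _ _ _), ?_⟩
  suffices h : ∀ i j, B p q ∣ B i j by
    intro i j
    simpa using h _ _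
  intro i j
  have hrow := dvd_row_of_minimal hmin hB h0 ha
  by_cases hi : i = p
  · rw [hi]; exact hrow j
  obtain ⟨c, hc⟩ := dvd_col_of_minimal hmin hB h0 ha i
  have hT := hB.trans (mul_left (U := transvection i p (1 - c))
    (by simp [det_transvection_of_ne _ _ hi]) B)
  have hq : (transvection i p (1 - c) * B) i q = B p q := by
    rw [transvection_mul_apply_same, hc]; ring
  have h := dvd_row_of_minimal hmin hT (i := i) (j := q) (by rwa [hq]) (by rwa [hq]) j
  rw [hq, transvection_mul_apply_same] at h
  exact (Int.dvd_add_left (Dvd.dvd.mul_left (hrow j) _)).mp h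

theorem fromBlocks_clear (A : Matrix (Unit ⊕ ι) (Unit ⊕ ι) ℤ)
    (h : ∀ i j, A (.inl ()) (.inl ()) ∣ A i j) :
    ∃ D : Matrix ι ι ℤ, (∀ i j, A (.inl ()) (.inl ()) ∣ D i j) ∧
      UnimodularEquiv A (fromBlocks (diagonal fun _ => A (.inl ()) (.inl ())) 0 0 D) := by
  choose q hq using h
  set a := A (.inl ()) (.inl ()) with ha
  let R : Matrix Unit ι ℤ := of fun _ j => q (.inl ()) (.inr j)
  let C : Matrix ι Unit ℤ := of fun i _ => q (.inr i) (.inl ())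
  let D : Matrix ι ι ℤ := of fun i j => A (.inr i) (.inr j) - a * (C i () * R () j)
  refine ⟨D, fun i j => dvd_sub ⟨_, hq _ _⟩ (Dvd.intro _ rfl), ?_⟩
  refine ⟨fromBlocks 1 0 (-C) 1, fromBlocks 1 (-R) 0 1, by simp, by simp, ?_⟩
  have hA : A = fromBlocks (diagonal fun _ => a) (of fun _ j => a * R () j)
      (of fun i _ => a * C i ()) (of fun i j => A (.inr i) (.inr j)) := by
    ext (i | i) (j | j)
    · simp [ha]
    · exact hq _ _
    · exact hq _ _
    · rfl
  rw [hA, fromBlocks_multiply, fromBlocks_multiply]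
  congr 1 <;> ext i j <;> simp [Matrix.mul_apply, D] <;> ring

theorem fromBlocks_diagonal {D D' : Matrix ι ι ℤ} (h : UnimodularEquiv D D') (a : ℤ) :
    UnimodularEquiv (fromBlocks (diagonal fun _ : Unit => a) 0 0 D)
      (fromBlocks (diagonal fun _ : Unit => a) 0 0 D') := by
  obtain ⟨U, V, hU, hV, rfl⟩ := h
  exact ⟨fromBlocks 1 0 0 U, fromBlocks 1 0 0 V, by simpa using hU, by simpa using hV,
    by simp [fromBlocks_multiply]⟩

/-- Smith normal form, up to signs. -/
theorem exists_diagonal : ∀ (N : ℕ) (A : Matrix (Fin N) (Fin N) ℤ), ∃ d : ℕ → ℤ,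
    (∀ i j, i ≤ j → j < N → d i ∣ d j) ∧
      UnimodularEquiv A (diagonal fun i : Fin N => d i)
  | 0, A => ⟨0, by simp, by
    rw [Subsingleton.elim A (diagonal _)]
    exact refl _⟩
  | N + 1, A => by
    by_cases hA : A = 0
    · exact ⟨0, by simp, by simpa [hA] using refl (0 : Matrix (Fin (N + 1)) (Fin (N + 1)) ℤ)⟩
    let e : Unit ⊕ Fin N ≃ Fin (N + 1) :=
      ((Equiv.sumComm _ _).trans (Equiv.optionEquivSumPUnit (Fin N)).symm).trans
        (finSuccEquiv N).symm
    have he0 : e (.inl ()) = 0 := by simp [e]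
    have hes (i : Fin N) : e (.inr i) = i.succ := by simp [e]
    obtain ⟨B, hAB, hB⟩ := exists_dvd_entries hA 0
    obtain ⟨D, hD, hBD⟩ := fromBlocks_clear (B.submatrix e e)
      (fun i j => by simpa [he0] using hB (e i) (e j))
    obtain ⟨d, hd, hDd⟩ := exists_diagonal N D
    simp only [submatrix_apply, he0] at hD hBD
    refine ⟨fun i => Nat.casesOn i (B 0 0) d, ?_, ?_⟩
    · rintro (_ | i) (_ | j) hij hj
      · exact dvd_rfl
      · simpa using hDd.dvd_of_forall_dvd hD ⟨j, by omega⟩ ⟨j, by omega⟩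
      · omega
      · exact hd i j (by omega) (by omega)
    · have h := (hBD.trans (hDd.fromBlocks_diagonal (B 0 0))).submatrix_equiv e.symm
      rw [Matrix.fromBlocks_diagonal, submatrix_submatrix] at h
      simp only [Equiv.self_comp_symm, submatrix_id_id] at h
      convert hAB.trans h using 1
      rw [submatrix_diagonal_equiv]
      congr 1
      ext i
      obtain ⟨i, rfl⟩ := e.surjective i
      simp only [Function.comp_apply, Equiv.symm_apply_apply]
      rcases i with i | i <;> simp [he0, hes]

theorem diagonal_abs (d : ι → ℤ) :
    UnimodularEquiv (diagonal d) (diagonal fun i => |d i|) := by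
  have h := mul_left (U := diagonal fun i => if d i < 0 then (-1 : ℤ) else 1) (by
    rw [det_diagonal, IsUnit.prod_univ_iff]
    intro i
    split_ifs <;> simp) (diagonal d)
  rw [diagonal_mul_diagonal] at h
  convert h using 3 with i
  split_ifs with hi
  · rw [abs_of_neg hi]; ring
  · rw [abs_of_nonneg (not_lt.mp hi)]; ring

/-- Smith normal form. -/
theorem exists_diagonal_nonneg {N : ℕ} (A : Matrix (Fin N) (Fin N) ℤ) : ∃ d : ℕ → ℤ,
    (∀ i, 0 ≤ d i) ∧ (∀ i j, i ≤ j → j < N → d i ∣ d j) ∧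
      UnimodularEquiv A (diagonal fun i : Fin N => d i) := by
  obtain ⟨d, hd, h⟩ := exists_diagonal N A
  exact ⟨fun i => |d i|, fun i => abs_nonneg _,
    fun i j hij hj => (abs_dvd_abs _ _).mpr (hd i j hij hj), h.trans (diagonal_abs _)⟩

end UnimodularEquiv

/-- The ideal generated by the `k × k` minors of a matrix. -/
def minorIdeal {R m n : Type*} [CommRing R] (k : ℕ) (A : Matrix m n R) : Ideal R :=
  Ideal.span (Set.range fun p : (Fin k → m) × (Fin k → n) => (A.submatrix p.1 p.2).det)

section MinorIdeal

variable {R l m n : Type*} [CommRing R] {k : ℕ}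

theorem det_submatrix_mem_minorIdeal {ι : Type*} [Fintype ι] [DecidableEq ι] (A : Matrix m n R)
    (hk : Fintype.card ι = k) (f : ι → m) (g : ι → n) :
    (A.submatrix f g).det ∈ minorIdeal k A := by
  let e : Fin k ≃ ι := (Fintype.equivFinOfCardEq hk).symm
  rw [← det_submatrix_equiv_self e, submatrix_submatrix]
  exact Ideal.subset_span ⟨(f ∘ e, g ∘ e), rfl⟩

theorem minorIdeal_le {A : Matrix m n R} {I : Ideal R}
    (h : ∀ (f : Fin k → m) (g : Fin k → n), (A.submatrix f g).det ∈ I) : minorIdeal k A ≤ I :=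
  Ideal.span_le.mpr (Set.range_subset_iff.mpr fun p => h p.1 p.2)

theorem minorIdeal_mul_le_right [Fintype m] (A : Matrix l m R) (B : Matrix m n R) :
    minorIdeal k (A * B) ≤ minorIdeal k B := by
  classical
  refine minorIdeal_le fun f g => ?_
  have h : (A * B).submatrix f g =
      fun i => ∑ j, A (f i) j • (B.submatrix id g) j := by
    ext i c
    simp [Matrix.mul_apply, Finset.sum_apply]
  change detRowAlternating.toMultilinearMap ((A * B).submatrix f g) ∈ _
  rw [h, MultilinearMap.map_sum]
  refine Ideal.sum_mem _ fun r _ => ?_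
  rw [MultilinearMap.map_smul_univ]
  exact Ideal.mul_mem_left _ _ (det_submatrix_mem_minorIdeal B (by simp) r g)

theorem minorIdeal_transpose_le (A : Matrix m n R) : minorIdeal k Aᵀ ≤ minorIdeal k A :=
  minorIdeal_le fun f g => by
    rw [← transpose_submatrix, det_transpose]
    exact det_submatrix_mem_minorIdeal A (by simp) g f

theorem minorIdeal_mul_le_left [Fintype m] (A : Matrix l m R) (B : Matrix m n R) :
    minorIdeal k (A * B) ≤ minorIdeal k A := by
  have h := minorIdeal_transpose_le (k := k) (A * B)ᵀ
  rw [transpose_transpose, transpose_mul] at h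
  exact h.trans ((minorIdeal_mul_le_right _ _).trans (minorIdeal_transpose_le A))

theorem minorIdeal_mul_mul_le {l' : Type*} [Fintype m] [Fintype n] (A : Matrix l m R)
    (B : Matrix m n R) (C : Matrix n l' R) : minorIdeal k (A * B * C) ≤ minorIdeal k B :=
  (minorIdeal_mul_le_left _ _).trans (minorIdeal_mul_le_right _ _)

theorem UnimodularEquiv.minorIdeal_eq {ι : Type*} [Fintype ι] [DecidableEq ι]
    {A B : Matrix ι ι ℤ} (h : UnimodularEquiv A B) : minorIdeal k A = minorIdeal k B := by
  apply le_antisymm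
  · obtain ⟨U, V, -, -, rfl⟩ := h.symm
    exact minorIdeal_mul_mul_le _ _ _
  · obtain ⟨U, V, -, -, rfl⟩ := h
    exact minorIdeal_mul_mul_le _ _ _

theorem minorIdeal_diagonal_le [DecidableEq m] {w : m → R} {x : R}
    (h : ∀ g : Fin k → m, g.Injective → x ∣ ∏ i, w (g i)) :
    minorIdeal k (diagonal w) ≤ Ideal.span {x} := by
  refine minorIdeal_le fun f g => Ideal.mem_span_singleton.mpr ?_
  by_cases hg : g.Injective
  · rw [det_apply']
    refine Finset.dvd_sum fun σ _ => Dvd.dvd.mul_left ?_ _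
    by_cases hσ : ∀ i, f (σ i) = g i
    · simpa [hσ] using h g hg
    · push Not at hσ
      obtain ⟨i, hi⟩ := hσ
      rw [Finset.prod_eq_zero (Finset.mem_univ i) (by simp [hi])]
      exact dvd_zero x
  · simp only [Function.Injective] at hg
    push Not at hg
    obtain ⟨i, j, hij, hne⟩ := hg
    rw [det_zero_of_column_eq hne fun r => by simp [hij]]
    exact dvd_zero x

theorem prod_range_dvd_prod_of_injective {N : ℕ} {d : ℕ → R}
    (hd : ∀ i j, i ≤ j → j < N → d i ∣ d j) (g : Fin k → Fin N) (hg : g.Injective) :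
    ∏ i ∈ Finset.range k, d i ∣ ∏ i, d (g i) := by
  have hcard : (Finset.univ.image g).card = k := by
    rw [Finset.card_image_of_injective _ hg, Finset.card_fin]
  let e := (Finset.univ.image g).orderEmbOfFin hcard
  have he : ∀ (i : ℕ) (hi : i < k), i ≤ (e ⟨i, hi⟩ : ℕ) := by
    intro i
    induction i with
    | zero => simp
    | succ i ih =>
      intro hi
      have h1 := ih (by omega)
      have h2 : (e ⟨i, by omega⟩ : ℕ) < e ⟨i + 1, hi⟩ :=
        e.strictMono (Fin.mk_lt_mk.mpr (Nat.lt_succ_self i))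
      omega
  have hprod : ∏ i, d (g i) = ∏ i, d (e i) := by
    rw [← Finset.prod_image (s := Finset.univ) (g := g) (f := fun x : Fin N => d x) hg.injOn,
      ← Finset.prod_image (s := Finset.univ) (g := e) (f := fun x : Fin N => d x)
        e.injective.injOn, Finset.image_orderEmbOfFin_univ]
  rw [hprod, ← Fin.prod_univ_eq_prod_range]
  exact Finset.prod_dvd_prod_of_dvd _ _ fun i _ => hd _ _ (he i i.2) (e i).2

theorem minorIdeal_diagonal_of_dvd {N : ℕ} {d : ℕ → R}
    (hd : ∀ i j, i ≤ j → j < N → d i ∣ d j) (hk : k ≤ N) :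
    minorIdeal k (diagonal fun i : Fin N => d i) = Ideal.span {∏ i ∈ Finset.range k, d i} := by
  apply le_antisymm
  · exact minorIdeal_diagonal_le fun g hg => prod_range_dvd_prod_of_injective hd g hg
  · rw [Ideal.span_singleton_le_iff_mem]
    have h := det_submatrix_mem_minorIdeal (diagonal fun i : Fin N => d i)
      (Fintype.card_fin k) (Fin.castLE hk) (Fin.castLE hk)
    rw [submatrix_diagonal _ _ (Fin.castLE_injective hk), det_diagonal] at h
    rw [← Fin.prod_univ_eq_prod_range]
    exact h

theorem minorIdeal_le_span_det [Fintype m] [DecidableEq m] (A : Matrix m m R)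
    (hk : Fintype.card m = k) : minorIdeal k A ≤ Ideal.span {A.det} := by
  refine minorIdeal_le fun f g => Ideal.mem_span_singleton.mpr ?_
  let e : m ≃ Fin k := Fintype.equivFinOfCardEq hk
  have h : A.submatrix (f ∘ e) (g ∘ e) =
      (1 : Matrix m m R).submatrix (f ∘ e) id * A * (1 : Matrix m m R).submatrix id (g ∘ e) := by
    ext i j
    simp [Matrix.mul_apply, Matrix.one_apply]
  rw [← det_submatrix_equiv_self e, submatrix_submatrix, h, det_mul, det_mul]
  exact Dvd.dvd.mul_right (Dvd.intro_left _ rfl) _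

theorem minorIdeal_eq_bot_of_card_lt [Fintype m] (A : Matrix m n R) (hk : Fintype.card m < k) :
    minorIdeal k A = ⊥ := by
  refine le_bot_iff.mp (minorIdeal_le fun f g => ?_)
  obtain ⟨i, j, hne, hij⟩ := Fintype.exists_ne_map_eq_of_card_lt f (by simpa using hk)
  rw [det_zero_of_row_eq hne (by ext; simp [hij])]
  exact zero_mem _

end MinorIdeal

section DiagonalAddConst

variable {R ι : Type*} [CommRing R] [Fintype ι] [DecidableEq ι]

theorem det_updateRow_diagonal (a v : ι → R) (i : ι) :
    ((diagonal a).updateRow i v).det = v i * ∏ j ∈ Finset.univ.erase i, a j := by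
  have h : ((diagonal a).updateCol i v).det = v i * ∏ j ∈ Finset.univ.erase i, a j := by
    rw [← cramer_apply, cramer_eq_adjugate_mulVec, adjugate_diagonal, mulVec_diagonal, mul_comm]
  rw [← h, ← det_transpose, ← updateCol_transpose, diagonal_transpose]

theorem det_diagonal_add_const (a : ι → R) (b : R) :
    (diagonal a + of fun _ _ => b).det =
      ∏ i, a i + b * ∑ i, ∏ j ∈ Finset.univ.erase i, a j := by
  have key (s : Finset ι) : (of fun i j => diagonal a i j + if i ∈ s then b else 0).det =
      ∏ i, a i + b * ∑ i ∈ s, ∏ j ∈ Finset.univ.erase i, a j := by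
    induction s using Finset.induction_on with
    | empty =>
      simp only [Finset.notMem_empty, if_false, add_zero, Finset.sum_empty, mul_zero]
      exact det_diagonal
    | insert x s hx ih =>
      set M : Matrix ι ι R := of fun i j => diagonal a i j + if i ∈ s then b else 0 with hM
      have h1 : (of fun i j => diagonal a i j + if i ∈ insert x s then b else 0) =
          M.updateRow x (M x + fun _ => b) := by
        ext i j
        by_cases hi : i = x
        · subst hi; simp [hM, hx]
        · simp [hM, hi]
      have h2 : (M.updateRow x fun _ => b).det = ((diagonal a).updateRow x fun _ => b).det := by
        refine det_eq_of_forall_row_eq_smul_add_const (fun i => if i ∈ s then 1 else 0) x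
          (by simp [hx]) fun i j => ?_
        by_cases hi : i = x
        · subst hi; simp [hx]
        · simp [hM, hi]
      rw [h1, det_updateRow_add, updateRow_eq_self, h2, ih, det_updateRow_diagonal,
        Finset.sum_insert hx]
      ring
  rw [← key Finset.univ]
  congr 1
  ext i j
  simp

theorem mul_prod_mem_minorIdeal (a : ι → R) (b : R) (s : Finset ι)
    (hs : s.card + 2 ≤ Fintype.card ι) :
    b * ∏ i ∈ s, a i ∈ minorIdeal (s.card + 1) (diagonal a + of fun _ _ => b) := by
  obtain ⟨x, hx, y, hy, hxy⟩ : ∃ x ∈ sᶜ, ∃ y ∈ sᶜ, x ≠ y :=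
    Finset.one_lt_card.mp (by rw [Finset.card_compl]; omega)
  rw [Finset.mem_compl] at hx hy
  have h := det_submatrix_mem_minorIdeal (k := s.card + 1) (diagonal a + of fun _ _ => b)
    (ι := Option s) (by simp) (fun o => o.elim x (↑)) (fun o => o.elim y (↑))
  have hM : (diagonal a + of fun _ _ => b).submatrix
      (fun o : Option s => o.elim x (↑)) (fun o : Option s => o.elim y (↑)) =
      diagonal (fun o : Option s => o.elim 0 fun i => a i) + of fun _ _ => b := by
    ext (_ | i) (_ | j)
    · simp [hxy]
    · simp [diagonal_apply_ne a (fun h : x = j => hx (h ▸ j.2))]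
    · simp [diagonal_apply_ne a (fun h : (i : ι) = y => hy (h ▸ i.2))]
    · simp [diagonal_apply]
  have hsome (i : s) : ∏ o ∈ Finset.univ.erase (some i),
      (fun o : Option s => o.elim 0 fun i => a i) o = 0 :=
    Finset.prod_eq_zero (i := none) (by simp) rfl
  have hnone : (Finset.univ : Finset (Option s)).erase none = Finset.univ.map .some := by
    ext (_ | i) <;> simp
  rw [hM, det_diagonal_add_const, Fintype.prod_option, Fintype.sum_option,
    Finset.sum_eq_zero fun i _ => hsome i, hnone, Finset.prod_map] at h
  simpa [Finset.prod_attach s a] using h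

theorem prod_mem_minorIdeal (a : ι → R) (b : R) (s : Finset ι)
    (hs : s.card + 1 ≤ Fintype.card ι) :
    ∏ i ∈ s, a i ∈ minorIdeal s.card (diagonal a + of fun _ _ => b) := by
  have h := det_submatrix_mem_minorIdeal (k := s.card) (diagonal a + of fun _ _ => b)
    (ι := s) (by simp) (↑) (↑)
  have hM : (diagonal a + of fun _ _ => b).submatrix ((↑) : s → ι) (↑) =
      diagonal (fun i : s => a i) + of fun _ _ => b := by
    ext i j
    simp [diagonal_apply]
  rw [hM, det_diagonal_add_const, Finset.prod_coe_sort s a] at h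
  refine (Ideal.add_mem_iff_left _ ?_).mp h
  rw [Finset.mul_sum]
  refine Ideal.sum_mem _ fun i _ => ?_
  have hprod : ∏ j ∈ Finset.univ.erase i, a j = ∏ j ∈ s.erase i, a j := by
    refine (Finset.prod_map _ (Function.Embedding.subtype (· ∈ s)) a).symm.trans ?_
    congr 1
    ext j
    simp [and_comm]
  have hcard := Finset.card_erase_add_one i.2
  have := mul_prod_mem_minorIdeal a b (s.erase i) (by omega)
  rw [hcard] at this
  rwa [hprod]

end DiagonalAddConst

section Pretzel

variable {m : ℕ}

theorem sum_fin_ite_eq (G : ℕ → ℤ) (r : ℕ) :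
    ∑ e : Fin m, (if r = (e : ℕ) then G e else 0) = if r < m then G r else 0 := by
  rw [Fin.sum_univ_eq_sum_range (fun e => if r = e then G e else 0) m]
  simp [Finset.sum_ite_eq]

/-- The Gram matrix of the weighted cycle on a basis of its cut lattice. -/
def pretzelGram (m : ℕ) (n : ℕ → ℤ) : Matrix (Fin m) (Fin m) ℤ :=
  diagonal (fun e : Fin m => n (e + 1)) + of fun _ _ => n (m + 1)

/-- Row differences: cyclically consecutive rows are subtracted, the last row being zero. -/
def rowDifference (m : ℕ) : Matrix (Fin (m + 1)) (Fin m) ℤ :=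
  of fun r e => (if (r : ℕ) = e then 1 else 0) - (if (r : ℕ) + 1 = e then 1 else 0) -
    (if (r : ℕ) = m ∧ (e : ℕ) = 0 then 1 else 0)

/-- The coboundary of the path with `m` edges. -/
def pathCoboundary (m : ℕ) : Matrix (Fin m) (Fin (m + 1)) ℤ :=
  of fun e c => (if (c : ℕ) = e + 1 then 1 else 0) - (if (c : ℕ) = e then 1 else 0)

theorem exists_mul_rowDifference_eq_one (m : ℕ) :
    ∃ X : Matrix (Fin m) (Fin (m + 1)) ℤ, X * rowDifference m = 1 := by
  refine ⟨of fun e r => if (e : ℕ) ≤ r ∧ (r : ℕ) < m then 1 else 0, ?_⟩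
  ext e f
  simp only [Matrix.mul_apply, rowDifference, of_apply]
  have hpred (r : ℕ) : r + 1 = (f : ℕ) ↔ r = (f : ℕ) - 1 ∧ 1 ≤ (f : ℕ) := by omega
  rw [Fin.sum_univ_eq_sum_range (fun r => (if (e : ℕ) ≤ r ∧ r < m then (1 : ℤ) else 0) *
    ((if r = (f : ℕ) then 1 else 0) - (if r + 1 = (f : ℕ) then 1 else 0) -
      (if r = m ∧ (f : ℕ) = 0 then 1 else 0))) (m + 1)]
  simp only [hpred, ite_and, mul_sub, mul_ite, mul_one, mul_zero, Finset.sum_sub_distrib,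
    Finset.sum_ite_eq', Finset.mem_range, one_apply, Fin.ext_iff]
  grind

theorem exists_pathCoboundary_mul_eq_one (m : ℕ) :
    ∃ Y : Matrix (Fin (m + 1)) (Fin m) ℤ, pathCoboundary m * Y = 1 := by
  refine ⟨of fun c f => if (f : ℕ) < c then 1 else 0, ?_⟩
  ext e f
  simp only [Matrix.mul_apply, pathCoboundary, of_apply]
  rw [Fin.sum_univ_eq_sum_range (fun c => ((if c = (e : ℕ) + 1 then (1 : ℤ) else 0) -
    (if c = (e : ℕ) then 1 else 0)) * if (f : ℕ) < c then 1 else 0) (m + 1)]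
  simp only [sub_mul, ite_mul, one_mul, zero_mul, Finset.sum_sub_distrib, Finset.sum_ite_eq',
    Finset.mem_range, one_apply, Fin.ext_iff]
  grind

theorem pretzelColoringMatrix_eq_mul (hm : 2 ≤ m) (n : ℕ → ℤ) :
    pretzelColoringMatrix (m + 1) n = rowDifference m * pretzelGram m n * pathCoboundary m := by
  have hQ : pretzelGram m n * pathCoboundary m = of fun (e : Fin m) (c : Fin (m + 1)) =>
      n (e + 1) * ((if (c : ℕ) = e + 1 then 1 else 0) - (if (c : ℕ) = e then 1 else 0)) +
        n (m + 1) * ((if (c : ℕ) = m then 1 else 0) - (if (c : ℕ) = 0 then 1 else 0)) := by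
    ext e c
    rw [pretzelGram, Matrix.add_mul, Matrix.add_apply, diagonal_mul]
    simp only [Matrix.mul_apply, pathCoboundary, of_apply, ← Finset.mul_sum,
      Finset.sum_sub_distrib]
    have h1 := sum_fin_ite_eq (m := m) (fun _ => 1) c
    have h2 : ∑ e : Fin m, (if (c : ℕ) = e + 1 then (1 : ℤ) else 0) =
        if (c : ℕ) = 0 then 0 else 1 := by
      rcases Nat.eq_zero_or_pos (c : ℕ) with h | h
      · simp [h]
      · have h3 := sum_fin_ite_eq (m := m) (fun _ => 1) ((c : ℕ) - 1)
        have h4 (e : Fin m) : (c : ℕ) = e + 1 ↔ (c : ℕ) - 1 = e := by omega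
        simp only [h4, h3]
        grind
    rw [h1, h2]
    grind
  rw [Matrix.mul_assoc, hQ]
  ext r c
  simp only [Matrix.mul_apply, of_apply, rowDifference]
  set Z : ℕ → ℤ := fun e => n (e + 1) * ((if (c : ℕ) = e + 1 then 1 else 0) -
    (if (c : ℕ) = e then 1 else 0)) +
      n (m + 1) * ((if (c : ℕ) = m then 1 else 0) - (if (c : ℕ) = 0 then 1 else 0)) with hZ
  rw [Fin.sum_univ_eq_sum_range (fun e => ((if (r : ℕ) = e then (1 : ℤ) else 0) -
    (if (r : ℕ) + 1 = e then 1 else 0) - (if (r : ℕ) = m ∧ e = 0 then 1 else 0)) * Z e) m]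
  have hlast : ∑ e ∈ Finset.range m, (if (r : ℕ) = m ∧ e = 0 then Z e else 0) =
      if (r : ℕ) = m then Z 0 else 0 := by
    split_ifs with h
    · simp [h, show 0 < m by omega]
    · simp [h]
  simp only [sub_mul, ite_mul, one_mul, zero_mul, Finset.sum_sub_distrib, Finset.sum_ite_eq,
    Finset.mem_range, hlast]
  simp only [hZ, pretzelColoringMatrix, of_apply]
  obtain ⟨r, hr⟩ := r
  obtain ⟨c, hc⟩ := c
  rcases lt_trichotomy (r + 1) m with h | rfl | h
  · rw [if_pos (by omega : r + 2 < m + 1), if_pos (by omega : r < m), if_pos h,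
      if_neg (by omega : ¬r = m)]
    grind
  · simp only [add_tsub_cancel_right]
    grind
  · obtain rfl : r = m := by omega
    grind

theorem minorIdeal_pretzelColoringMatrix (hm : 2 ≤ m) (n : ℕ → ℤ) (k : ℕ) :
    minorIdeal k (pretzelColoringMatrix (m + 1) n) = minorIdeal k (pretzelGram m n) := by
  have hP := pretzelColoringMatrix_eq_mul hm n
  apply le_antisymm
  · rw [hP]
    exact minorIdeal_mul_mul_le _ _ _
  · obtain ⟨X, hX⟩ := exists_mul_rowDifference_eq_one m
    obtain ⟨Y, hY⟩ := exists_pathCoboundary_mul_eq_one m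
    have hQ : pretzelGram m n = X * pretzelColoringMatrix (m + 1) n * Y := by
      rw [hP, Matrix.mul_assoc, Matrix.mul_assoc, hY, Matrix.mul_one, ← Matrix.mul_assoc, hX,
        Matrix.one_mul]
    rw [hQ]
    exact minorIdeal_mul_mul_le _ _ _

theorem pretzelGram_eq_mul (m : ℕ) (n : ℕ → ℤ) :
    ∃ A : Matrix (Fin m) (Fin (m + 1)) ℤ,
      pretzelGram m n = A * (diagonal fun e : Fin (m + 1) => n (e + 1)) * Aᵀ := by
  refine ⟨of fun i e => Fin.lastCases 1 (fun j => if i = j then 1 else 0) e, ?_⟩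
  ext i j
  rw [Matrix.mul_apply, Fin.sum_univ_castSucc]
  simp only [pretzelGram, Matrix.add_apply, diagonal_apply, of_apply, mul_diagonal,
    Fin.lastCases_castSucc, Fin.lastCases_last, transpose_apply]
  by_cases h : i = j
  · subst h; simp
  · simp [h]

theorem minorIdeal_pretzelGram_le (n : ℕ → ℤ) (k : ℕ) :
    minorIdeal k (pretzelGram m n) ≤
      Ideal.span {((Finset.Icc 1 (m + 1)).powersetCard k).gcd (fun T => ∏ s ∈ T, n s)} := by
  obtain ⟨A, hA⟩ := pretzelGram_eq_mul m n
  rw [hA]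
  refine (minorIdeal_mul_mul_le _ _ _).trans (minorIdeal_diagonal_le fun g hg => ?_)
  have hinj : Function.Injective fun i : Fin k => (g i : ℕ) + 1 := fun i j h =>
    hg (Fin.ext (by simpa using h))
  rw [← Finset.prod_image (s := Finset.univ) (g := fun i => (g i : ℕ) + 1) (f := n) hinj.injOn]
  refine Finset.gcd_dvd (Finset.mem_powersetCard.mpr ⟨?_, ?_⟩)
  · intro x hx
    simp only [Finset.mem_image, Finset.mem_univ, true_and] at hx
    obtain ⟨i, rfl⟩ := hx
    have := (g i).2
    rw [Finset.mem_Icc]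
    omega
  · rw [Finset.card_image_of_injective _ hinj, Finset.card_fin]

/-- The embedding of `Fin m` in `ℕ` with image `{1, …, m}`. -/
def finSuccEmbedding (m : ℕ) : Fin m ↪ ℕ := Fin.valEmbedding.trans (addRightEmbedding 1)

@[simp]
theorem finSuccEmbedding_apply (i : Fin m) : finSuccEmbedding m i = i + 1 := rfl

theorem map_finSuccEmbedding (m : ℕ) :
    Finset.univ.map (finSuccEmbedding m) = Finset.Icc 1 m := by
  ext x
  simp only [Finset.mem_Icc, Finset.mem_map, Finset.mem_univ, true_and, finSuccEmbedding_apply]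
  constructor
  · rintro ⟨i, rfl⟩
    omega
  · exact fun h => ⟨⟨x - 1, by omega⟩, Nat.sub_add_cancel h.1⟩

theorem exists_eq_map_of_subset_Icc {T : Finset ℕ} (hT : T ⊆ Finset.Icc 1 m) :
    ∃ S : Finset (Fin m), S.card = T.card ∧
      ∀ n : ℕ → ℤ, ∏ s ∈ T, n s = ∏ i ∈ S, n (i + 1) := by
  obtain ⟨S, -, rfl⟩ := Finset.subset_map_iff.mp (map_finSuccEmbedding m ▸ hT)
  exact ⟨S, (Finset.card_map _).symm, fun n => Finset.prod_map _ _ _⟩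

theorem prod_mem_minorIdeal_pretzelGram (n : ℕ → ℤ) {T : Finset ℕ}
    (hT : T ⊆ Finset.Icc 1 (m + 1)) (hcard : T.card + 1 ≤ m) :
    ∏ s ∈ T, n s ∈ minorIdeal T.card (pretzelGram m n) := by
  by_cases hmem : m + 1 ∈ T
  · have hsub : T.erase (m + 1) ⊆ Finset.Icc 1 m := by
      intro x hx
      rw [Finset.mem_erase] at hx
      have := Finset.mem_Icc.mp (hT hx.2)
      rw [Finset.mem_Icc]
      omega
    obtain ⟨S, hS, hprod⟩ := exists_eq_map_of_subset_Icc hsub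
    have hc := Finset.card_erase_add_one hmem
    have h := mul_prod_mem_minorIdeal (fun e : Fin m => n (e + 1)) (n (m + 1)) S
      (by rw [Fintype.card_fin]; omega)
    rwa [← hprod, Finset.mul_prod_erase _ _ hmem, hS, hc] at h
  · have hsub : T ⊆ Finset.Icc 1 m := by
      intro x hx
      have := Finset.mem_Icc.mp (hT hx)
      have : x ≠ m + 1 := fun h => hmem (h ▸ hx)
      rw [Finset.mem_Icc]
      omega
    obtain ⟨S, hS, hprod⟩ := exists_eq_map_of_subset_Icc hsub
    have h := prod_mem_minorIdeal (fun e : Fin m => n (e + 1)) (n (m + 1)) S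
      (by rw [Fintype.card_fin]; omega)
    rwa [← hprod, hS] at h

theorem sum_powersetCard_prod {ι : Type*} [DecidableEq ι] {k : ℕ} (s : Finset ι)
    (hs : s.card = k + 1) (n : ι → ℤ) :
    ∑ T ∈ s.powersetCard k, ∏ i ∈ T, n i = ∑ x ∈ s, ∏ i ∈ s.erase x, n i := by
  have h : s.powersetCard k = s.image s.erase := by
    ext T
    simp only [Finset.mem_powersetCard, Finset.mem_image]
    constructor
    · rintro ⟨hT, hc⟩
      obtain ⟨x, hx⟩ := Finset.card_eq_one.mp
        (show (s \ T).card = 1 by rw [Finset.card_sdiff_of_subset hT]; omega)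
      refine ⟨x, ?_, ?_⟩
      · exact (Finset.mem_sdiff.mp (hx ▸ Finset.mem_singleton_self x)).1
      · rw [← Finset.sdiff_singleton_eq_erase, ← hx, Finset.sdiff_sdiff_eq_self hT]
    · rintro ⟨x, hx, rfl⟩
      exact ⟨Finset.erase_subset _ _, by rw [Finset.card_erase_of_mem hx]; omega⟩
  rw [h, Finset.sum_image (Finset.erase_injOn s)]

theorem det_pretzelGram (n : ℕ → ℤ) :
    (pretzelGram m n).det = ∑ T ∈ (Finset.Icc 1 (m + 1)).powersetCard m, ∏ s ∈ T, n s := by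
  have hIcc : Finset.Icc 1 (m + 1) = insert (m + 1) (Finset.Icc 1 m) := by
    ext x
    simp only [Finset.mem_Icc, Finset.mem_insert]
    omega
  have hnot : m + 1 ∉ Finset.Icc 1 m := by simp
  rw [sum_powersetCard_prod _ (by simp), hIcc, Finset.sum_insert hnot, Finset.erase_insert hnot,
    pretzelGram, det_diagonal_add_const, Finset.mul_sum]
  congr 1
  · rw [← map_finSuccEmbedding, Finset.prod_map]
    rfl
  · rw [← map_finSuccEmbedding, Finset.sum_map]
    refine Finset.sum_congr rfl fun i _ => ?_
    rw [Finset.erase_insert_of_ne (by rw [finSuccEmbedding_apply]; omega),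
      Finset.prod_insert fun h => hnot (map_finSuccEmbedding m ▸ Finset.mem_of_mem_erase h),
      ← Finset.map_erase, Finset.prod_map]
    rfl

end Pretzel

/-- Let `N > 2` and let `n 1, …, n N` be positive integers.
With `Δ i` (for `1 ≤ i ≤ N-2`) the gcd of all products of `i` of the `n`'s with
strictly increasing indices, and `Δ (N-1)` the sum of all products of `N-1` of the
`n`'s with strictly increasing indices, there exist `N × N` integer matrices `U`, `V`
of determinant `±1` and integers `d 1, …, d (N-1)` such that
`U * P(n 1, …, n N) * V` is the diagonal matrix `diag (d 1, …, d (N-1), 0)` with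
`d 1 = Δ 1` and `d i * Δ (i-1) = Δ i` for `2 ≤ i ≤ N-1`. -/
theorem pretzelColoringMatrix_diagonalization (N : ℕ) (hN : 2 < N) (n : ℕ → ℤ)
    (hn : ∀ k, 1 ≤ k → k ≤ N → 0 < n k) (Δ : ℕ → ℤ)
    (hΔ : ∀ i, 1 ≤ i → i ≤ N - 2 →
      Δ i = ((Finset.Icc 1 N).powersetCard i).gcd (fun T => ∏ s ∈ T, n s))
    (hΔtop : Δ (N - 1) = ∑ T ∈ (Finset.Icc 1 N).powersetCard (N - 1), ∏ s ∈ T, n s) :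
    ∃ (U V : Matrix (Fin N) (Fin N) ℤ) (d : ℕ → ℤ),
      (U.det = 1 ∨ U.det = -1) ∧ (V.det = 1 ∨ V.det = -1) ∧
      U * pretzelColoringMatrix N n * V =
        Matrix.diagonal (fun j : Fin N => if (j : ℕ) + 1 = N then 0 else d ((j : ℕ) + 1)) ∧
      d 1 = Δ 1 ∧ (∀ i, 2 ≤ i → i ≤ N - 1 → d i * Δ (i - 1) = Δ i) := by
  obtain ⟨m, rfl⟩ : ∃ m, N = m + 1 := ⟨N - 1, by omega⟩
  have hm : 2 ≤ m := by omega
  simp only [add_tsub_cancel_right, show m + 1 - 2 = m - 1 by omega] at hΔ hΔtop ⊢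
  obtain ⟨d, hd0, hd, hequiv⟩ :=
    UnimodularEquiv.exists_diagonal_nonneg (pretzelColoringMatrix (m + 1) n)
  have hideal (k : ℕ) (hk : k ≤ m + 1) :
      minorIdeal k (pretzelGram m n) = Ideal.span {∏ i ∈ Finset.range k, d i} := by
    rw [← minorIdeal_pretzelColoringMatrix hm, hequiv.minorIdeal_eq,
      minorIdeal_diagonal_of_dvd hd hk]
  have hnonneg (k : ℕ) : 0 ≤ ∏ i ∈ Finset.range k, d i := Finset.prod_nonneg fun i _ => hd0 i
  have hlow (k : ℕ) (hk1 : 1 ≤ k) (hk : k ≤ m - 1) : ∏ i ∈ Finset.range k, d i = Δ k := by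
    rw [hΔ k hk1 hk]
    refine Int.dvd_antisymm (hnonneg k) (Int.nonneg_of_normalize_eq_self Finset.normalize_gcd)
      (Finset.dvd_gcd fun T hT => ?_) ?_
    · obtain ⟨hsub, rfl⟩ := Finset.mem_powersetCard.mp hT
      rw [← Ideal.mem_span_singleton, ← hideal _ (by omega)]
      exact prod_mem_minorIdeal_pretzelGram n hsub (by omega)
    · rw [← Ideal.span_singleton_le_span_singleton, ← hideal _ (by omega)]
      exact minorIdeal_pretzelGram_le n k
  have hpos : 0 < Δ m := by
    rw [hΔtop]
    refine Finset.sum_pos (fun T hT => Finset.prod_pos fun s hs => ?_)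
      (Finset.powersetCard_nonempty.mpr (by simp))
    have := Finset.mem_Icc.mp ((Finset.mem_powersetCard.mp hT).1 hs)
    exact hn s this.1 this.2
  have htop : ∏ i ∈ Finset.range m, d i = Δ m := by
    refine Int.dvd_antisymm (hnonneg m) hpos.le ?_ ?_
    · rw [hΔtop, ← det_pretzelGram, ← Ideal.mem_span_singleton, ← hideal m (by omega)]
      exact det_submatrix_mem_minorIdeal _ (by simp) id id
    · rw [hΔtop, ← det_pretzelGram, ← Ideal.span_singleton_le_span_singleton,
        ← hideal m (by omega)]
      exact minorIdeal_le_span_det _ (by simp)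
  have hlast : d m = 0 := by
    have h := hideal (m + 1) le_rfl
    rw [minorIdeal_eq_bot_of_card_lt _ (by simp), eq_comm, Ideal.span_singleton_eq_bot,
      Finset.prod_range_succ, htop] at h
    exact (mul_eq_zero.mp h).resolve_left hpos.ne'
  have hprod (k : ℕ) (hk1 : 1 ≤ k) (hk : k ≤ m) : ∏ i ∈ Finset.range k, d i = Δ k := by
    rcases hk.lt_or_eq with h | rfl
    · exact hlow k hk1 (by omega)
    · exact htop
  obtain ⟨U, V, hU, hV, hUV⟩ := hequiv
  refine ⟨U, V, fun i => d (i - 1), Int.isUnit_iff.mp hU, Int.isUnit_iff.mp hV, ?_, ?_, ?_⟩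
  · rw [hUV]
    congr 1
    ext j
    split_ifs with h
    · rw [show (j : ℕ) = m by omega, hlast]
    · simp
  · simpa using hprod 1 le_rfl (by omega)
  · intro i hi him
    obtain ⟨j, rfl⟩ : ∃ j, i = j + 1 := ⟨i - 1, by omega⟩
    rw [add_tsub_cancel_right, ← hprod j (by omega) (by omega), ← hprod (j + 1) (by omega) him,
      Finset.prod_range_succ, mul_comm]
    rfl
end

section
/- Let n_1, n_2, n_3 be positive integers and let g = gcd(n_1, n_2, n_3). Then there exist 3×3 integer matrices U and V of determinant ±1 such that U · P(n_1, n_2, n_3) · V is the diagonal matrix with diagonal entries g, (n_1·n_2 + n_1·n_3 + n_2·n_3)/g, 0 (the middle entry being the exact integer quotient of n_1·n_2 + n_1·n_3 + n_2·n_3 by g). -/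
/-- If a `2 × 2` integer matrix with nonzero determinant has coprime entries, then adding a suitable
multiple of its second column to its first makes the first column unimodular. -/
theorem exists_isCoprime_add_mul_of_det_ne_zero {a b c d : ℤ} (hdet : a * d - b * c ≠ 0)
    (hprim : ∀ p : ℕ, p.Prime → (p : ℤ) ∣ a → (p : ℤ) ∣ b → (p : ℤ) ∣ c → ¬ (p : ℤ) ∣ d) :
    ∃ k : ℤ, IsCoprime (a + k * b) (c + k * d) := by
  classical
  let s : Finset ℕ := (a * d - b * c).natAbs.primeFactors.filter
    fun p : ℕ => ¬ ((p : ℤ) ∣ a ∧ (p : ℤ) ∣ c)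
  obtain ⟨k, hk⟩ : ∃ k : ℕ, k = ∏ p ∈ s, p := ⟨_, rfl⟩
  refine ⟨k, ?_⟩
  rw [Int.isCoprime_iff_gcd_eq_one]
  by_contra hne
  obtain ⟨p, hp, hpd⟩ := Nat.exists_prime_and_dvd hne
  have hpZ : Prime (p : ℤ) := Nat.prime_iff_prime_int.mp hp
  have h1 : (p : ℤ) ∣ a + k * b :=
    (Int.natCast_dvd_natCast.mpr hpd).trans (Int.gcd_dvd_left _ _)
  have h2 : (p : ℤ) ∣ c + k * d :=
    (Int.natCast_dvd_natCast.mpr hpd).trans (Int.gcd_dvd_right _ _)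
  by_cases hac : (p : ℤ) ∣ a ∧ (p : ℤ) ∣ c
  · have hpk : ¬ (p : ℤ) ∣ k := by
      rw [Int.natCast_dvd_natCast, hk, hp.prime.dvd_finsetProd_iff]
      rintro ⟨q, hq, hpq⟩
      obtain ⟨hq1, hq2⟩ := Finset.mem_filter.mp hq
      obtain rfl := (Nat.prime_dvd_prime_iff_eq hp (Nat.prime_of_mem_primeFactors hq1)).mp hpq
      exact hq2 hac
    have hb := (hpZ.dvd_or_dvd ((dvd_add_right hac.1).mp h1)).resolve_left hpk
    have hd := (hpZ.dvd_or_dvd ((dvd_add_right hac.2).mp h2)).resolve_left hpk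
    exact hprim p hp hac.1 hb hac.2 hd
  · have hpdet : (p : ℤ) ∣ a * d - b * c := by
      have hcomb : a * d - b * c = (a + k * b) * d - (c + k * d) * b := by ring
      exact hcomb ▸ dvd_sub (h1.mul_right d) (h2.mul_right b)
    have hps : p ∈ s := Finset.mem_filter.mpr
      ⟨Nat.mem_primeFactors.mpr ⟨hp, Int.natCast_dvd.mp hpdet, Int.natAbs_ne_zero.mpr hdet⟩, hac⟩
    have hpk : (p : ℤ) ∣ k := Int.natCast_dvd_natCast.mpr (hk ▸ Finset.dvd_prod_of_mem _ hps)
    exact hac ⟨(dvd_add_left (hpk.mul_right b)).mp h1, (dvd_add_left (hpk.mul_right d)).mp h2⟩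

/-- Let `n₁, n₂, n₃` be positive integers and
`g = gcd (n₁, n₂, n₃)`. Then there are `3 × 3` integer matrices `U`, `V` of
determinant `±1` such that `U * P(n₁, n₂, n₃) * V` is the diagonal matrix with
diagonal entries `g`, `(n₁*n₂ + n₁*n₃ + n₂*n₃)/g` (an exact integer quotient)
and `0`, where `P(n₁, n₂, n₃)` is the pretzel coloring matrix with rows
`(-n₁, n₁+n₂, -n₂)`, `(-n₃, -n₂, n₂+n₃)`, `(n₃+n₁, -n₁, -n₃)`. -/
theorem pretzel3_diagonalization (n₁ n₂ n₃ : ℤ)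
    (h₁ : 0 < n₁) (h₂ : 0 < n₂) (h₃ : 0 < n₃) :
    ∃ U V : Matrix (Fin 3) (Fin 3) ℤ,
      (U.det = 1 ∨ U.det = -1) ∧ (V.det = 1 ∨ V.det = -1) ∧
      U * !![-n₁, n₁ + n₂, -n₂; -n₃, -n₂, n₂ + n₃; n₃ + n₁, -n₁, -n₃] * V =
        Matrix.diagonal
          ![(Int.gcd (Int.gcd n₁ n₂) n₃ : ℤ),
            (n₁ * n₂ + n₁ * n₃ + n₂ * n₃) / (Int.gcd (Int.gcd n₁ n₂) n₃ : ℤ),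
            0] := by
  set g : ℤ := (Int.gcd (Int.gcd n₁ n₂) n₃ : ℤ) with hg
  have hg12 : g ∣ (Int.gcd n₁ n₂ : ℤ) := Int.gcd_dvd_left _ _
  obtain ⟨m₁, hm₁⟩ : g ∣ n₁ := hg12.trans (Int.gcd_dvd_left _ _)
  obtain ⟨m₂, hm₂⟩ : g ∣ n₂ := hg12.trans (Int.gcd_dvd_right _ _)
  obtain ⟨m₃, hm₃⟩ : g ∣ n₃ := Int.gcd_dvd_right _ _
  have hg0 : 0 < g := by
    refine lt_of_le_of_ne (Int.natCast_nonneg _) fun h => ?_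
    rw [← h, zero_mul] at hm₁
    exact h₁.ne' hm₁
  have hm₁pos : 0 < m₁ := pos_of_mul_pos_right (hm₁ ▸ h₁) hg0.le
  have hm₂pos : 0 < m₂ := pos_of_mul_pos_right (hm₂ ▸ h₂) hg0.le
  have hm₃pos : 0 < m₃ := pos_of_mul_pos_right (hm₃ ▸ h₃) hg0.le
  have hprim (p : ℕ) (hp : p.Prime) (hp₁ : (p : ℤ) ∣ m₁) (hp₂ : (p : ℤ) ∣ m₂) :
      ¬ (p : ℤ) ∣ m₃ := by
    intro hp₃
    have hgp : g * p ∣ g := Int.dvd_coe_gcd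
      (Int.dvd_coe_gcd (hm₁ ▸ mul_dvd_mul_left g hp₁) (hm₂ ▸ mul_dvd_mul_left g hp₂))
      (hm₃ ▸ mul_dvd_mul_left g hp₃)
    have hunit : (p : ℤ) ∣ 1 := (mul_dvd_mul_iff_left hg0.ne').mp (by rwa [mul_one])
    exact (Nat.prime_iff_prime_int.mp hp).not_isUnit (isUnit_of_dvd_one hunit)
  obtain ⟨k, u, v, huv⟩ := exists_isCoprime_add_mul_of_det_ne_zero
    (a := -m₁) (b := -m₂) (c := -m₃) (d := m₂ + m₃)
    (by
      have : 0 < m₁ * m₂ + m₁ * m₃ + m₂ * m₃ := by positivity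
      intro h
      linarith)
    (fun p hp ha hb hc _ => hprim p hp ((dvd_neg).mp ha) ((dvd_neg).mp hb) ((dvd_neg).mp hc))
  have hquot : (n₁ * n₂ + n₁ * n₃ + n₂ * n₃) / g = g * (m₁ * m₂ + m₁ * m₃ + m₂ * m₃) := by
    apply Int.ediv_eq_of_eq_mul_right hg0.ne'
    rw [hm₁, hm₂, hm₃]
    ring
  rw [hquot]
  clear_value g
  subst hm₁ hm₂ hm₃
  set t := -u * m₂ + v * (m₂ + m₃) with ht
  refine ⟨!![u, v, 0; -m₃ + k * (m₂ + m₃), -(-m₁ + k * -m₂), 0; 1, 1, 1],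
    !![1, -t, 1; 0, 0, 1; k, 1 - t * k, 1], Or.inr ?_, Or.inr ?_, ?_⟩
  · rw [Matrix.det_fin_three]
    simp
    linear_combination -huv
  · rw [Matrix.det_fin_three]
    simp
    ring
  · ext i j
    fin_cases i <;> fin_cases j <;> simp [Matrix.mul_apply, Fin.sum_univ_three]
    · linear_combination g * huv
    · linear_combination -g * t * huv - g * ht
    all_goals ring
end

section
/- Let N ≥ 3 be an integer and i_1, …, i_N nonnegative integers. Let S be the (N−1)×(N−1) integer matrix with entries S_{j,k} = i_N + 1 if j < k, S_{j,j} = i_j + i_N + 1, and S_{j,k} = i_N if j > k. Then, in the polynomial ring ℤ[t], det(t·S − Sᵀ) = Σ_{k=1}^{N−2} (−1)^{k+N−1} · ((i_N+1)·t − i_N) · ∏_{j=1}^{k−1} (i_j·t − (i_j+1)) · ∏_{j=k+1}^{N−1} (i_j − (i_j+1)·t) + (i_{N−1}+i_N+1)·(t−1) · ∏_{k=1}^{N−2} (i_k·t − (i_k+1)). -/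
open Polynomial Matrix

/-- The `(N-1) × (N-1)` Seifert matrix of the pretzel knot
`P(2 i 1 + 1, …, 2 i N + 1)`: entries `i N + 1` above the diagonal, `i j + i N + 1`
on the diagonal (at the `j`-th row, 1-based), and `i N` below the diagonal. -/
def seifertOddPretzel (N : ℕ) (i : ℕ → ℕ) : Matrix (Fin (N - 1)) (Fin (N - 1)) ℤ :=
  Matrix.of fun j k =>
    if (j : ℕ) < (k : ℕ) then (i N : ℤ) + 1
    else if j = k then (i ((j : ℕ) + 1) : ℤ) + (i N : ℤ) + 1
    else (i N : ℤ)

namespace Matrix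

variable {R : Type*} [CommRing R]

/-- The determinant of a matrix depends affinely on a scalar added to all of its entries. -/
theorem exists_det_add_of_const {n : Type*} [Fintype n] [DecidableEq n] (M : Matrix n n R) :
    ∃ e : R, ∀ s : R, (M + of fun _ _ => s).det = M.det + s * e := by
  let B : Matrix (Unit ⊕ n) (Unit ⊕ n) R := fromBlocks 1 (of fun _ _ => 1) 0 M
  let w : Unit ⊕ n → R := Sum.elim 0 (fun _ => -1)
  refine ⟨(B.updateCol (Sum.inl ()) w).det, fun s => ?_⟩
  have hB : (fromBlocks 1 (of fun _ _ => 1) (of fun _ _ => -s) M : Matrix (Unit ⊕ n) (Unit ⊕ n) R)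
      = B.updateCol (Sum.inl ()) ((fun j => B j (Sum.inl ())) + s • w) := by
    ext j k
    rcases j with j | j <;> rcases k with k | k <;> simp [B, w]
  have h₁ : (M + of fun _ _ => s).det =
      (fromBlocks 1 (of fun _ _ => 1) (of fun _ _ => -s) M :
        Matrix (Unit ⊕ n) (Unit ⊕ n) R).det := by
    rw [det_fromBlocks_one₁₁]
    congr 1
    ext j k
    simp [mul_apply]
  have h₂ : B.det = M.det := by simp [B, det_fromBlocks_zero₂₁]
  rw [h₁, hB, det_updateCol_add, det_updateCol_smul, updateCol_eq_self, h₂]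

/-- The determinant of a matrix with constant entries `a` above the diagonal and `b` below it. -/
theorem sub_mul_det_of_const_above_below {n : ℕ} (a b : R) (d : Fin n → R) :
    (a - b) * (of fun j k : Fin n => if j < k then a else if j = k then d j else b).det =
      a * ∏ j, (d j - b) - b * ∏ j, (d j - a) := by
  set M : Matrix (Fin n) (Fin n) R :=
    of fun j k => if j < k then a else if j = k then d j else b with hM
  obtain ⟨e, he⟩ := exists_det_add_of_const M
  have ha : (M + of fun _ _ => -a).det = ∏ j, (d j - a) := by
    rw [det_of_isLowerTriangular]
    · simp [hM, sub_eq_add_neg]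
    · intro j k hjk
      have hjk' : j < k := hjk
      simp [hM, hjk']
  have hb : (M + of fun _ _ => -b).det = ∏ j, (d j - b) := by
    rw [det_of_isUpperTriangular]
    · simp [hM, sub_eq_add_neg]
    · intro j k hjk
      have hjk' : k < j := hjk
      simp [hM, hjk'.not_gt, hjk'.ne']
  rw [he] at ha hb
  rw [← ha, ← hb]
  ring

end Matrix

/-- Telescoping of `∏ Q - ∏ P` when all the differences `Q k - P k` coincide. -/
theorem mul_sum_prod_mul_prod_eq_prod_sub_prod {R : Type*} [CommRing R] {P Q : ℕ → R} {c : R}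
    (h : ∀ k, Q k - P k = c) (n : ℕ) :
    c * ∑ k ∈ Finset.Icc 1 n, (∏ j ∈ Finset.Icc 1 (k - 1), P j) * ∏ j ∈ Finset.Icc (k + 1) n, Q j =
      ∏ j ∈ Finset.Icc 1 n, Q j - ∏ j ∈ Finset.Icc 1 n, P j := by
  induction n with
  | zero => simp
  | succ n ih =>
    have hQ : ∑ k ∈ Finset.Icc 1 n,
          (∏ j ∈ Finset.Icc 1 (k - 1), P j) * ∏ j ∈ Finset.Icc (k + 1) (n + 1), Q j =
        (∑ k ∈ Finset.Icc 1 n,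
          (∏ j ∈ Finset.Icc 1 (k - 1), P j) * ∏ j ∈ Finset.Icc (k + 1) n, Q j) * Q (n + 1) := by
      rw [Finset.sum_mul]
      refine Finset.sum_congr rfl fun k hk => ?_
      have hk' := (Finset.mem_Icc.mp hk).2
      rw [Finset.prod_Icc_succ_top (by lia), mul_assoc]
    rw [Finset.sum_Icc_succ_top (by lia), hQ, Nat.add_sub_cancel,
      Finset.Icc_eq_empty (by lia : ¬ n + 1 + 1 ≤ n + 1), Finset.prod_empty,
      Finset.prod_Icc_succ_top (by lia), Finset.prod_Icc_succ_top (by lia), mul_add, ← mul_assoc,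
      ih, ← h (n + 1)]
    ring

/-- For `N ≥ 3` and nonnegative integers `i 1, …, i N`, the
determinant of `t • S - Sᵀ` (over `ℤ[t]`, with `S` the above Seifert matrix) is
`∑_{k=1}^{N-2} (-1)^{k+N-1} ((i N + 1) t - i N) ∏_{j=1}^{k-1} (i j · t - (i j + 1))
  ∏_{j=k+1}^{N-1} (i j - (i j + 1) t)
+ (i (N-1) + i N + 1)(t-1) ∏_{k=1}^{N-2} (i k · t - (i k + 1))`. -/
theorem seifertOddPretzel_alexander (N : ℕ) (hN : 3 ≤ N) (i : ℕ → ℕ) :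
    ((X : ℤ[X]) • ((seifertOddPretzel N i).map C)
        - ((seifertOddPretzel N i).map C)ᵀ).det =
      (∑ k ∈ Finset.Icc 1 (N - 2),
        (-1 : ℤ[X]) ^ (k + N - 1) * (((i N : ℤ[X]) + 1) * X - (i N : ℤ[X])) *
          (∏ j ∈ Finset.Icc 1 (k - 1), ((i j : ℤ[X]) * X - ((i j : ℤ[X]) + 1))) *
          (∏ j ∈ Finset.Icc (k + 1) (N - 1), ((i j : ℤ[X]) - ((i j : ℤ[X]) + 1) * X)))
      + ((i (N - 1) : ℤ[X]) + (i N : ℤ[X]) + 1) * (X - 1) *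
          ∏ k ∈ Finset.Icc 1 (N - 2), ((i k : ℤ[X]) * X - ((i k : ℤ[X]) + 1)) := by
  obtain ⟨m, rfl⟩ : ∃ m, N = m + 2 := ⟨N - 2, by lia⟩
  simp only [Nat.add_sub_cancel, show m + 2 - 1 = m + 1 from rfl]
  set q : ℤ[X] := (i (m + 2) : ℤ[X]) with hq
  set P : ℕ → ℤ[X] := fun j => (i j : ℤ[X]) * X - ((i j : ℤ[X]) + 1) with hP
  set Q : ℕ → ℤ[X] := fun j => ((i j : ℤ[X]) + 1) * X - (i j : ℤ[X]) with hQ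
  set a : ℤ[X] := (q + 1) * X - q with ha
  set b : ℤ[X] := q * X - (q + 1) with hb
  have hab : a - b = X + 1 := by rw [ha, hb]; ring
  have hPQ : ∀ k, Q k - P k = X + 1 := fun k => by simp only [hP, hQ]; ring
  have hne : (X + 1 : ℤ[X]) ≠ 0 := by simpa using X_add_C_ne_zero (1 : ℤ)
  have hM : (X : ℤ[X]) • ((seifertOddPretzel (m + 2) i).map C)
        - ((seifertOddPretzel (m + 2) i).map C)ᵀ =
      of fun j k : Fin (m + 1) => if j < k then a else if j = k then
        ((i ((j : ℕ) + 1) : ℤ[X]) + q + 1) * (X - 1) else b := by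
    ext1 j k
    rcases lt_trichotomy j k with h | rfl | h
    · simp [seifertOddPretzel, h, h.not_gt, h.ne', ha, hq]
      ring
    · simp [seifertOddPretzel, hq]
      ring
    · simp [seifertOddPretzel, h, h.not_gt, h.ne', hb, hq]
      ring
  have hdet := sub_mul_det_of_const_above_below a b
    fun j : Fin (m + 1) => ((i ((j : ℕ) + 1) : ℤ[X]) + q + 1) * (X - 1)
  have hprod : ∀ f : ℕ → ℤ[X],
      ∏ j : Fin (m + 1), f ((j : ℕ) + 1) = ∏ j ∈ Finset.Icc 1 (m + 1), f j := fun f => by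
    rw [Fin.prod_univ_eq_prod_range (fun j => f (j + 1)), Finset.range_eq_Ico,
      Finset.prod_Ico_add' f 0 (m + 1) 1]
    rfl
  have hPprod : ∏ j : Fin (m + 1), (((i ((j : ℕ) + 1) : ℤ[X]) + q + 1) * (X - 1) - a) =
      ∏ j ∈ Finset.Icc 1 (m + 1), P j := by
    rw [← hprod]
    exact Finset.prod_congr rfl fun j _ => by simp only [hP, ha]; ring
  have hQprod : ∏ j : Fin (m + 1), (((i ((j : ℕ) + 1) : ℤ[X]) + q + 1) * (X - 1) - b) =
      ∏ j ∈ Finset.Icc 1 (m + 1), Q j := by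
    rw [← hprod]
    exact Finset.prod_congr rfl fun j _ => by simp only [hQ, hb]; ring
  have hsum : ∑ k ∈ Finset.Icc 1 m, (-1 : ℤ[X]) ^ (k + (m + 2) - 1) * a *
        (∏ j ∈ Finset.Icc 1 (k - 1), P j) *
        (∏ j ∈ Finset.Icc (k + 1) (m + 1), ((i j : ℤ[X]) - ((i j : ℤ[X]) + 1) * X)) =
      a * ∑ k ∈ Finset.Icc 1 m,
        (∏ j ∈ Finset.Icc 1 (k - 1), P j) * ∏ j ∈ Finset.Icc (k + 1) (m + 1), Q j := by
    rw [Finset.mul_sum]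
    refine Finset.sum_congr rfl fun k hk => ?_
    obtain ⟨r, rfl⟩ := Nat.exists_eq_add_of_le (Finset.mem_Icc.mp hk).2
    have hneg : ∏ j ∈ Finset.Icc (k + 1) (k + r + 1), ((i j : ℤ[X]) - ((i j : ℤ[X]) + 1) * X) =
        (-1) ^ (r + 1) * ∏ j ∈ Finset.Icc (k + 1) (k + r + 1), Q j := by
      have hcard : (Finset.Icc (k + 1) (k + r + 1)).card = r + 1 := by
        rw [Nat.card_Icc]; lia
      rw [← hcard, ← Finset.prod_neg]
      exact Finset.prod_congr rfl fun j _ => by simp only [hQ]; ring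
    have hsign : (-1 : ℤ[X]) ^ (k + (k + r + 2) - 1) * (-1) ^ (r + 1) = 1 := by
      rw [← pow_add]
      exact Even.neg_one_pow ⟨k + r + 1, by lia⟩
    rw [hneg]
    linear_combination (a * (∏ j ∈ Finset.Icc 1 (k - 1), P j) *
      ∏ j ∈ Finset.Icc (k + 1) (k + r + 1), Q j) * hsign
  have htel := mul_sum_prod_mul_prod_eq_prod_sub_prod hPQ (m + 1)
  rw [Finset.sum_Icc_succ_top (by lia), Nat.add_sub_cancel,
    Finset.Icc_eq_empty (by lia : ¬ m + 1 + 1 ≤ m + 1), Finset.prod_empty, mul_one] at htel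
  have hlast : ∏ j ∈ Finset.Icc 1 (m + 1), P j = (∏ j ∈ Finset.Icc 1 m, P j) * P (m + 1) :=
    Finset.prod_Icc_succ_top (by lia) _
  have hdiag : ((i (m + 1) : ℤ[X]) + q + 1) * (X - 1) = P (m + 1) + a := by
    simp only [hP, ha]; ring
  rw [hPprod, hQprod, hab] at hdet
  rw [hM, hsum, hdiag]
  refine mul_left_cancel₀ hne (hdet.trans ?_)
  linear_combination -a * htel + (∏ j ∈ Finset.Icc 1 (m + 1), P j) * hab + (X + 1) * hlast
end

section
/- Let i ≥ 1 be an integer and m = 2i − 1. Let B'' be the m×m matrix over the polynomial ring ℤ[t] whose entries are: B''_{j,j} = 1 for 1 ≤ j ≤ m−1, B''_{m,m} = 1 − t, B''_{j,j−1} = t for 2 ≤ j ≤ m, B''_{j,m} = −t for 1 ≤ j ≤ m−1, and all other entries zero. Then det B'' = Σ_{j=1}^{m−1} (−1)^j · t^{m+1−j} + (1 − t). -/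
open Polynomial

/-- The matrix with diagonal `(1, …, 1, 1 + x)`, constant subdiagonal `-x` and the remaining entries
of the last column equal to `x` has a geometric sum as determinant. -/
theorem det_subdiagonal_lastCol {R : Type*} [CommRing R] (x : R) (n : ℕ) :
    (Matrix.of (fun j k : Fin (n + 1) =>
        if (j : ℕ) + 1 = n + 1 ∧ (k : ℕ) + 1 = n + 1 then 1 + x
        else if (k : ℕ) + 1 = n + 1 then x
        else if (k : ℕ) + 1 = (j : ℕ) then -x
        else if j = k then 1
        else 0)).det
      = ∑ k ∈ Finset.range (n + 2), x ^ k := by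
  let L : Matrix (Fin (n + 1)) (Fin (n + 1)) R := Matrix.of fun j l =>
    (if l = j then 1 else 0) + (if (l : ℕ) + 1 = j then -x else 0)
  let U : Matrix (Fin (n + 1)) (Fin (n + 1)) R := Matrix.of fun l k =>
    if (k : ℕ) = n then
      ∑ p ∈ Finset.range ((l : ℕ) + 1), x ^ (p + 1) + (if (l : ℕ) = n then 1 else 0)
    else if l = k then 1 else 0
  have hL : L.det = 1 := by
    rw [Matrix.det_of_isLowerTriangular L]
    · simp [L]
    · intro j l hjl
      have hlt : j < l := hjl
      have h₁ : l ≠ j := hlt.ne'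
      have h₂ : (l : ℕ) + 1 ≠ j := by omega
      simp [L, h₁, h₂]
  have hU : U.det = ∑ k ∈ Finset.range (n + 2), x ^ k := by
    rw [Matrix.det_of_isUpperTriangular (M := U), Fin.prod_univ_castSucc]
    · have h (j : Fin n) : (j : ℕ) ≠ n := j.isLt.ne
      simp [U, h, Finset.sum_range_succ' _ (n + 1)]
    · intro l k hlk
      have hlt : k < l := hlk
      have h₁ : l ≠ k := hlt.ne'
      have h₂ : (k : ℕ) ≠ n := by omega
      simp [U, h₁, h₂]
  trans (L * U).det
  swap
  · rw [Matrix.det_mul, hL, hU, one_mul]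
  congr 1
  ext j k
  rw [Matrix.mul_apply]
  simp only [L, U, Matrix.of_apply, add_mul, Finset.sum_add_distrib, ite_mul, one_mul, zero_mul,
    Finset.sum_ite_eq', Finset.mem_univ, if_true]
  induction j using Fin.cases with
  | zero =>
    simp only [Fin.val_zero, Nat.add_one_ne_zero, if_false, Finset.sum_const_zero, add_zero,
      zero_add, Finset.sum_range_one, pow_one, Fin.ext_iff]
    split_ifs <;> grind
  | succ j =>
    have h (l : Fin (n + 1)) : (l : ℕ) + 1 = (j.succ : Fin (n + 1)) ↔ l = j.castSucc := by
      simp [Fin.ext_iff]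
    simp only [h, Finset.sum_ite_eq', Finset.mem_univ, if_true]
    have hj : (j : ℕ) ≠ n := j.isLt.ne
    have hs : ∑ p ∈ Finset.range ((j : ℕ) + 1 + 1), x ^ (p + 1)
        = x * ∑ p ∈ Finset.range ((j : ℕ) + 1), x ^ (p + 1) + x := by
      rw [Finset.sum_range_succ', Finset.mul_sum]
      simp [pow_succ']
    simp only [Fin.val_succ, Fin.val_castSucc, Fin.ext_iff, hs, hj, if_false]
    split_ifs <;> first | omega | ring

/-- Let `i ≥ 1` and `m = 2*i - 1`. Let `B''` be the `m × m`
matrix over `ℤ[t]` with `B'' j j = 1` for `1 ≤ j ≤ m-1`, `B'' m m = 1 - t`,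
`B'' j (j-1) = t` for `2 ≤ j ≤ m`, `B'' j m = -t` for `1 ≤ j ≤ m-1`, and all other
entries zero (1-based description; the matrix below is 0-based). Then
`det B'' = ∑_{j=1}^{m-1} (-1)^j t^(m+1-j) + (1 - t)`. -/
theorem detB''_even_tassel (i m : ℕ) (hi : 1 ≤ i) (hm : m = 2 * i - 1) :
    (Matrix.of (fun j k : Fin m =>
        if (j : ℕ) + 1 = m ∧ (k : ℕ) + 1 = m then 1 - (X : ℤ[X])
        else if (k : ℕ) + 1 = m then -X
        else if (k : ℕ) + 1 = (j : ℕ) then X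
        else if j = k then 1
        else 0)).det
      = ∑ j ∈ Finset.Icc 1 (m - 1), (-1 : ℤ[X]) ^ j * X ^ (m + 1 - j) + (1 - X) := by
  obtain ⟨n, rfl⟩ : ∃ n, m = n + 1 := ⟨m - 1, by omega⟩
  have h := det_subdiagonal_lastCol (-X : ℤ[X]) n
  rw [neg_neg, ← sub_eq_add_neg] at h
  have hsum : ∑ j ∈ Finset.Icc 1 n, (-1 : ℤ[X]) ^ j * X ^ (n + 1 + 1 - j)
      = ∑ k ∈ Finset.range n, (-X : ℤ[X]) ^ (k + 2) := by
    refine Finset.sum_bij' (fun j _ => n - j) (fun k _ => n - k) ?_ ?_ ?_ ?_ ?_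
    any_goals intro j hj; simp only [Finset.mem_Icc, Finset.mem_range] at hj ⊢; omega
    intro j hj
    rw [Finset.mem_Icc] at hj
    have hparity : Even j ↔ Even (n - j + 2) := by grind
    rw [neg_pow (X : ℤ[X]), neg_one_pow_congr hparity, show n + 1 + 1 - j = n - j + 2 by omega]
  rw [h, Nat.add_sub_cancel, hsum, Finset.sum_range_succ', Finset.sum_range_succ']
  ring
end
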